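/- Let M_p be a weight sequence satisfying (M.1), (M.2)' and (M.3)', let W ⊆ ℝ^d be an unbounded set, and let ω : ℝ^d → (0,∞) be measurable with: for every R > 0 there is C_R > 0 such that ω(x+h) ≤ C_R ω(x) for all x ∈ ℝ^d and |h| ≤ R. A Beurling ultradistribution f of class (M_p) on ℝ^d satisfies sup_{h∈W} |⟨f, φ(·−h)⟩|/ω(h) < ∞ for every φ ∈ D^{(M_p)}(ℝ^d) if and only if for every R > 0 there exist continuous functions f_α : W_R → ℂ (α ∈ ℕ^d), where W_R := W + B(0,R), and some ℓ > 0, C > 0 with |f_α(x)| ≤ C (ℓ^{|α|}/M_α) ω(x) for all x ∈ W_R and α ∈ ℕ^d, such that ⟨f,φ⟩ = Σ_{α∈ℕ^d} (−1)^{|α|} ∫ f_α(x) ∂^αφ(x) dx (absolutely convergent) for every φ ∈ D^{(M_p)}(ℝ^d) with supp φ ⊂ W_R. -/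

import Mathlib

open MeasureTheory Real
open scoped BigOperators Pointwise

noncomputable section

/-- `ℝ^d` with the Euclidean norm. -/
abbrev Rd (d : ℕ) := EuclideanSpace ℝ (Fin d)

/-- Condition (M.1): a positive, logarithmically convex weight sequence. -/
def IsM1 (M : ℕ → ℝ) : Prop :=
  (∀ p, 0 < M p) ∧ ∀ p : ℕ, 1 ≤ p → (M p) ^ 2 ≤ M (p - 1) * M (p + 1)

/-- Condition (M.2)'. -/
def IsM2' (M : ℕ → ℝ) : Prop :=
  ∃ A H : ℝ, 1 ≤ A ∧ 1 ≤ H ∧ ∀ p : ℕ, M (p + 1) ≤ A * H ^ p * M p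

/-- Condition (M.2). -/
def IsM2 (M : ℕ → ℝ) : Prop :=
  ∃ A H : ℝ, 1 ≤ A ∧ 1 ≤ H ∧ ∀ p q : ℕ, M (p + q) ≤ A * H ^ (p + q) * M p * M q

/-- Condition (M.3)'. -/
def IsM3' (M : ℕ → ℝ) : Prop := Summable fun p : ℕ => M p / M (p + 1)

/-- Condition (M.3). -/
def IsM3 (M : ℕ → ℝ) : Prop :=
  IsM3' M ∧ ∃ c₀ > (0 : ℝ), ∀ q : ℕ, 1 ≤ q →
    (∑' j : ℕ, M (q + j - 1) / M (q + j)) ≤ c₀ * q * (M (q - 1) / M q)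

/-- The associated function `M(t) = sup_p log (t^p M 0 / M p)`, with `M(0) = 0`. -/
def assocFn (M : ℕ → ℝ) (t : ℝ) : ℝ :=
  if t = 0 then 0 else ⨆ p : ℕ, Real.log (t ^ p * M 0 / M p)

variable {d : ℕ}

/-- The partial derivative in the `i`-th coordinate direction. -/
def pder (i : Fin d) (f : Rd d → ℂ) : Rd d → ℂ :=
  fun x => fderiv ℝ f x (EuclideanSpace.single i 1)

/-- The multi-index partial derivative `∂^α`. -/
def mderiv (α : Fin d → ℕ) (f : Rd d → ℂ) : Rd d → ℂ :=
  (List.finRange d).foldr (fun i g => (pder i)^[α i] g) f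

/-- The order `|α|` of a multi-index. -/
def mOrd (α : Fin d → ℕ) : ℕ := ∑ i, α i

/-- The factorial `α!` of a multi-index. -/
def mFact (α : Fin d → ℕ) : ℕ := ∏ i, Nat.factorial (α i)

/-- The set of quotients defining the norm of `E^{M_p,ℓ}(K)`. -/
def ESet (M : ℕ → ℝ) (ℓ : ℝ) (K : Set (Rd d)) (φ : Rd d → ℂ) : Set ℝ :=
  {r | ∃ (α : Fin d → ℕ) (x : Rd d), x ∈ K ∧
    r = ‖mderiv α φ x‖ / (ℓ ^ mOrd α * M (mOrd α))}

/-- `‖φ‖_{E^{M_p,ℓ}(K)}`. -/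
def Enorm (M : ℕ → ℝ) (ℓ : ℝ) (K : Set (Rd d)) (φ : Rd d → ℂ) : ℝ :=
  sSup (ESet M ℓ K φ)

/-- Finiteness of `‖φ‖_{E^{M_p,ℓ}(K)}`. -/
def EnormFin (M : ℕ → ℝ) (ℓ : ℝ) (K : Set (Rd d)) (φ : Rd d → ℂ) : Prop :=
  BddAbove (ESet M ℓ K φ)

/-- Membership in the test space `D^{(M_p)}(ℝ^d)`. -/
def IsTestD (M : ℕ → ℝ) (φ : Rd d → ℂ) : Prop :=
  ContDiff ℝ (⊤ : ℕ∞) φ ∧ HasCompactSupport φ ∧ ∀ ℓ > (0 : ℝ), EnormFin M ℓ (tsupport φ) φ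

/-- `f` is a Beurling ultradistribution of class `(M_p)`. -/
def IsUltraD (M : ℕ → ℝ) (f : (Rd d → ℂ) →ₗ[ℂ] ℂ) : Prop :=
  ∀ K : Set (Rd d), IsCompact K → ∃ ℓ > (0 : ℝ), ∃ C > (0 : ℝ), ∀ φ : Rd d → ℂ,
    IsTestD M φ → tsupport φ ⊆ K → ‖f φ‖ ≤ C * Enorm M ℓ K φ

/-- Euclidean dot product. -/
def dotR (ξ t : Rd d) : ℝ := ∑ i, ξ i * t i

/-- The window `t ↦ conj(ψ(t-x)) e^{-2πi ξ·t}` of the short-time Fourier transform. -/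
def windowFn (ψ : Rd d → ℂ) (x ξ : Rd d) : Rd d → ℂ :=
  fun t => (starRingEnd ℂ) (ψ (t - x)) * Complex.exp (-(2 * Real.pi * dotR ξ t : ℝ) * Complex.I)

/-- The short-time Fourier transform of a function `φ` with respect to the window `ψ`. -/
def STFTf (ψ φ : Rd d → ℂ) (x ξ : Rd d) : ℂ := ∫ t, φ t * windowFn ψ x ξ t

/-- The short-time Fourier transform of a linear functional `f` w.r.t. the window `ψ`. -/
def STFTd (f : (Rd d → ℂ) →ₗ[ℂ] ℂ) (ψ : Rd d → ℂ) (x ξ : Rd d) : ℂ := f (windowFn ψ x ξ)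

/-- The weight condition (5): `ω(·+x)/ω(x)` locally uniformly bounded. -/
def OmegaCond (ω : Rd d → ℝ) : Prop :=
  (∀ x, 0 < ω x) ∧ Measurable ω ∧
    ∀ R > (0 : ℝ), ∃ C > (0 : ℝ), ∀ x h : Rd d, ‖h‖ ≤ R → ω (x + h) ≤ C * ω x

/-! ### Calculus of multi-index derivatives -/

lemma mOrd_zero : mOrd (0 : Fin d → ℕ) = 0 := by simp [mOrd]

lemma mOrd_add (α β : Fin d → ℕ) : mOrd (α + β) = mOrd α + mOrd β := by
  simp [mOrd, Finset.sum_add_distrib]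

lemma mOrd_single (i : Fin d) (n : ℕ) : mOrd (Pi.single i n) = n := by
  simp [mOrd]

/-- Induction on multi-indices, raising one component at a time. -/
lemma multiIndex_induction {P : (Fin d → ℕ) → Prop} (h0 : P 0)
    (hs : ∀ α i, P α → P (α + Pi.single i 1)) (α : Fin d → ℕ) : P α := by
  induction h : mOrd α generalizing α with
  | zero =>
    have : α = 0 := by
      funext i
      exact (Finset.sum_eq_zero_iff.mp h) i (Finset.mem_univ i)
    rwa [this]
  | succ n ih =>
    obtain ⟨i, hi⟩ : ∃ i, α i ≠ 0 := by
      by_contra! hc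
      have : mOrd α = 0 := by simp [mOrd, hc]
      omega
    have hα : (α - Pi.single i 1) + Pi.single i 1 = α := by
      funext j
      by_cases hj : j = i
      · subst hj; simp; omega
      · simp [hj]
    rw [← hα]
    apply hs
    apply ih
    have := mOrd_add (α - Pi.single i 1) (Pi.single i 1)
    rw [hα, mOrd_single] at this
    omega

lemma contDiff_pder {f : Rd d → ℂ} (hf : ContDiff ℝ (⊤ : ℕ∞) f) (i : Fin d) :
    ContDiff ℝ (⊤ : ℕ∞) (pder i f) :=
  (hf.fderiv_right (by simp)).clm_apply contDiff_const

lemma contDiff_pder_iterate {f : Rd d → ℂ} (hf : ContDiff ℝ (⊤ : ℕ∞) f) (i : Fin d) (n : ℕ) :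
    ContDiff ℝ (⊤ : ℕ∞) ((pder i)^[n] f) := by
  induction n with
  | zero => simpa
  | succ n ih => rw [Function.iterate_succ_apply']; exact contDiff_pder ih i

lemma pder_comm {f : Rd d → ℂ} (hf : ContDiff ℝ (⊤ : ℕ∞) f) (i j : Fin d) :
    pder i (pder j f) = pder j (pder i f) := by
  have hd : Differentiable ℝ (fderiv ℝ f) :=
    (hf.fderiv_right (m := (⊤ : ℕ∞)) (by simp)).differentiable (by simp)
  have key : ∀ (v w : Rd d) (x : Rd d),
      fderiv ℝ (fun y => fderiv ℝ f y v) x w = fderiv ℝ (fderiv ℝ f) x w v := by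
    intro v w x
    rw [fderiv_clm_apply (hd x) (differentiableAt_const v)]
    simp
  funext x
  have hs : IsSymmSndFDerivAt ℝ f x :=
    hf.contDiffAt.isSymmSndFDerivAt (by
      rw [minSmoothness_of_isRCLikeNormedField]
      exact WithTop.coe_le_coe.mpr le_top)
  unfold pder
  rw [key, key]
  exact hs _ _

lemma pder_iterate_comm {f : Rd d → ℂ} (hf : ContDiff ℝ (⊤ : ℕ∞) f) (i j : Fin d) (n : ℕ) :
    (pder i)^[n] (pder j f) = pder j ((pder i)^[n] f) := by
  induction n with
  | zero => rfl
  | succ n ih =>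
    rw [Function.iterate_succ_apply', ih, Function.iterate_succ_apply',
      pder_comm (contDiff_pder_iterate hf i n)]

/-- Partial derivatives along a list of directions, the list version of `mderiv`. -/
def listDeriv (l : List (Fin d)) (α : Fin d → ℕ) (f : Rd d → ℂ) : Rd d → ℂ :=
  l.foldr (fun i g => (pder i)^[α i] g) f

lemma listDeriv_cons (i : Fin d) (l : List (Fin d)) (α : Fin d → ℕ) (f : Rd d → ℂ) :
    listDeriv (i :: l) α f = (pder i)^[α i] (listDeriv l α f) := rfl

lemma contDiff_listDeriv {f : Rd d → ℂ} (hf : ContDiff ℝ (⊤ : ℕ∞) f) (l : List (Fin d))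
    (α : Fin d → ℕ) : ContDiff ℝ (⊤ : ℕ∞) (listDeriv l α f) := by
  induction l with
  | nil => exact hf
  | cons i l ih => exact contDiff_pder_iterate ih i _

lemma listDeriv_pder {f : Rd d → ℂ} (hf : ContDiff ℝ (⊤ : ℕ∞) f) (l : List (Fin d))
    (α : Fin d → ℕ) (i : Fin d) : listDeriv l α (pder i f) = pder i (listDeriv l α f) := by
  induction l with
  | nil => rfl
  | cons j l ih =>
    rw [listDeriv_cons, ih, pder_iterate_comm (contDiff_listDeriv hf l α), listDeriv_cons]

lemma listDeriv_add_single {f : Rd d → ℂ} (hf : ContDiff ℝ (⊤ : ℕ∞) f) {l : List (Fin d)}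
    (hl : l.Nodup) (α : Fin d → ℕ) (i : Fin d) :
    listDeriv l (α + Pi.single i 1) f
      = if i ∈ l then pder i (listDeriv l α f) else listDeriv l α f := by
  induction l with
  | nil => rfl
  | cons j l ih =>
    rw [List.nodup_cons] at hl
    rw [listDeriv_cons, ih hl.2, listDeriv_cons]
    by_cases hij : i = j
    · subst hij
      simp [hl.1, Function.iterate_succ_apply']
    · by_cases hil : i ∈ l
      · simp [hil, Ne.symm hij, pder_iterate_comm (contDiff_listDeriv hf l α)]
      · simp [hil, hij, Ne.symm hij]

lemma contDiff_mderiv {f : Rd d → ℂ} (hf : ContDiff ℝ (⊤ : ℕ∞) f) (α : Fin d → ℕ) :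
    ContDiff ℝ (⊤ : ℕ∞) (mderiv α f) := contDiff_listDeriv hf _ α

lemma mderiv_pder {f : Rd d → ℂ} (hf : ContDiff ℝ (⊤ : ℕ∞) f) (α : Fin d → ℕ) (i : Fin d) :
    mderiv α (pder i f) = pder i (mderiv α f) := listDeriv_pder hf _ α i

lemma mderiv_add_single {f : Rd d → ℂ} (hf : ContDiff ℝ (⊤ : ℕ∞) f) (α : Fin d → ℕ) (i : Fin d) :
    mderiv (α + Pi.single i 1) f = pder i (mderiv α f) := by
  have := listDeriv_add_single hf (List.nodup_finRange d) α i
  rwa [if_pos (List.mem_finRange i)] at this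

lemma mderiv_zero (f : Rd d → ℂ) : mderiv 0 f = f := by
  unfold mderiv
  induction List.finRange d with
  | nil => rfl
  | cons i l ih => exact ih

lemma pder_add {f g : Rd d → ℂ} (hf : ContDiff ℝ (⊤ : ℕ∞) f) (hg : ContDiff ℝ (⊤ : ℕ∞) g)
    (i : Fin d) : pder i (f + g) = pder i f + pder i g := by
  funext x
  simp [pder, fderiv_add (hf.differentiable (by simp) x) (hg.differentiable (by simp) x)]

lemma pder_smul {f : Rd d → ℂ} (hf : ContDiff ℝ (⊤ : ℕ∞) f) (c : ℂ) (i : Fin d) :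
    pder i (c • f) = c • pder i f := by
  funext x
  simp [pder, fderiv_const_smul (hf.differentiable (by simp) x) c]

lemma pder_mul {f g : Rd d → ℂ} (hf : ContDiff ℝ (⊤ : ℕ∞) f) (hg : ContDiff ℝ (⊤ : ℕ∞) g)
    (i : Fin d) : pder i (f * g) = pder i f * g + f * pder i g := by
  funext x
  simp [pder, fderiv_mul (hf.differentiable (by simp) x) (hg.differentiable (by simp) x)]
  ring

lemma mderiv_add {f g : Rd d → ℂ} (hf : ContDiff ℝ (⊤ : ℕ∞) f) (hg : ContDiff ℝ (⊤ : ℕ∞) g)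
    (α : Fin d → ℕ) : mderiv α (f + g) = mderiv α f + mderiv α g := by
  induction α using multiIndex_induction with
  | h0 => simp [mderiv_zero]
  | hs α i ih =>
    rw [mderiv_add_single (f := f + g) (hf.add hg), ih, mderiv_add_single hf, mderiv_add_single hg,
      pder_add (contDiff_mderiv hf α) (contDiff_mderiv hg α)]

lemma mderiv_smul {f : Rd d → ℂ} (hf : ContDiff ℝ (⊤ : ℕ∞) f) (c : ℂ)
    (α : Fin d → ℕ) : mderiv α (c • f) = c • mderiv α f := by
  induction α using multiIndex_induction with
  | h0 => simp [mderiv_zero]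
  | hs α i ih =>
    rw [mderiv_add_single (f := c • f) (contDiff_const.smul hf), ih, mderiv_add_single hf,
      pder_smul (contDiff_mderiv hf α)]

lemma mderiv_const_zero (α : Fin d → ℕ) : mderiv α (0 : Rd d → ℂ) = 0 := by
  simpa using mderiv_smul (contDiff_const (c := (0 : ℂ)) : ContDiff ℝ (⊤ : ℕ∞) (0 : Rd d → ℂ)) 0 α

lemma mderiv_comp_sub {f : Rd d → ℂ} (hf : ContDiff ℝ (⊤ : ℕ∞) f) (h : Rd d) (α : Fin d → ℕ) :
    mderiv α (fun x => f (x - h)) = fun x => mderiv α f (x - h) := by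
  induction α using multiIndex_induction with
  | h0 => simp [mderiv_zero]
  | hs α i ih =>
    rw [mderiv_add_single (f := fun x => f (x - h)) (hf.comp (contDiff_id.sub contDiff_const)), ih, mderiv_add_single hf]
    funext x
    simp [pder, fderiv_comp_sub]

lemma tsupport_mderiv_subset {f : Rd d → ℂ} (hf : ContDiff ℝ (⊤ : ℕ∞) f) (α : Fin d → ℕ) :
    tsupport (mderiv α f) ⊆ tsupport f := by
  induction α using multiIndex_induction with
  | h0 => simp [mderiv_zero]
  | hs α i ih =>
    rw [mderiv_add_single hf]
    refine (closure_minimal ?_ (isClosed_tsupport _)).trans ih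
    intro x hx
    apply support_fderiv_subset ℝ
    intro h
    apply hx
    simp [pder, h]

lemma mderiv_eq_zero {f : Rd d → ℂ} (hf : ContDiff ℝ (⊤ : ℕ∞) f) (α : Fin d → ℕ) {x : Rd d}
    (hx : x ∉ tsupport f) : mderiv α f x = 0 :=
  image_eq_zero_of_notMem_tsupport fun h => hx (tsupport_mderiv_subset hf α h)

/-- The multi-index binomial coefficient. -/
def mChoose (α β : Fin d → ℕ) : ℕ := ∏ i, (α i).choose (β i)

lemma mChoose_eq_zero {α β : Fin d → ℕ} (h : ¬ β ≤ α) : mChoose α β = 0 := by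
  obtain ⟨i, hi⟩ : ∃ i, α i < β i := by
    by_contra! hc
    exact h hc
  exact Finset.prod_eq_zero (Finset.mem_univ i) (Nat.choose_eq_zero_of_lt hi)

lemma mChoose_le (α β : Fin d → ℕ) : mChoose α β ≤ 2 ^ mOrd α := by
  rw [mOrd, ← Finset.prod_pow_eq_pow_sum]
  exact Finset.prod_le_prod' fun i _ => Nat.choose_le_two_pow _ _

lemma mChoose_zero (α : Fin d → ℕ) : mChoose α 0 = 1 := by simp [mChoose]

lemma mChoose_split (α β : Fin d → ℕ) (i : Fin d) :
    mChoose α β = (α i).choose (β i) * ∏ j ∈ Finset.univ.erase i, (α j).choose (β j) :=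
  (Finset.mul_prod_erase _ (fun j => (α j).choose (β j)) (Finset.mem_univ i)).symm

lemma mChoose_add_single_single (α β : Fin d → ℕ) (i : Fin d) :
    mChoose (α + Pi.single i 1) (β + Pi.single i 1)
      = mChoose α β + mChoose α (β + Pi.single i 1) := by
  rw [mChoose_split _ _ i, mChoose_split α β i, mChoose_split α (β + Pi.single i 1) i]
  have h1 : ∏ j ∈ Finset.univ.erase i, ((α + Pi.single i 1 : Fin d → ℕ) j).choose ((β + Pi.single i 1 : Fin d → ℕ) j)
      = ∏ j ∈ Finset.univ.erase i, (α j).choose (β j) :=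
    Finset.prod_congr rfl fun j hj => by simp [Finset.ne_of_mem_erase hj]
  have h2 : ∏ j ∈ Finset.univ.erase i, (α j).choose ((β + Pi.single i 1 : Fin d → ℕ) j)
      = ∏ j ∈ Finset.univ.erase i, (α j).choose (β j) :=
    Finset.prod_congr rfl fun j hj => by simp [Finset.ne_of_mem_erase hj]
  rw [h1, h2, ← add_mul]
  simp [Nat.choose_succ_succ]

lemma mChoose_add_single_of_eq_zero (α β : Fin d → ℕ) (i : Fin d) (hi : β i = 0) :
    mChoose (α + Pi.single i 1) β = mChoose α β := by
  rw [mChoose_split _ _ i, mChoose_split α β i]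
  congr 1
  · simp [hi]
  · exact Finset.prod_congr rfl fun j hj => by simp [Finset.ne_of_mem_erase hj]

/-- Pascal's rule, summed against an arbitrary family. -/
lemma sum_mChoose_add_single (α : Fin d → ℕ) (i : Fin d) (t : (Fin d → ℕ) → ℂ) :
    ∑ β ∈ Finset.Iic (α + Pi.single i 1), (mChoose (α + Pi.single i 1) β : ℂ) * t β
      = ∑ β ∈ Finset.Iic α, (mChoose α β : ℂ) * (t (β + Pi.single i 1) + t β) := by
  have hle : ∀ β ∈ Finset.Iic α, β + Pi.single i 1 ∈ Finset.Iic (α + Pi.single i 1) := by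
    intro β hβ
    rw [Finset.mem_Iic] at *
    exact add_le_add_left hβ _
  have key : ∀ β, (mChoose (α + Pi.single i 1) β : ℂ) * t β
      = (if β i = 0 then 0 else (mChoose α (β - Pi.single i 1) : ℂ) * t β)
        + (mChoose α β : ℂ) * t β := by
    intro β
    split_ifs with h
    · rw [mChoose_add_single_of_eq_zero _ _ _ h, zero_add]
    · have hβ : (β - Pi.single i 1) + Pi.single i 1 = β := by
        funext j
        by_cases hj : j = i
        · subst hj; simp; omega
        · simp [hj]
      have := mChoose_add_single_single α (β - Pi.single i 1) i
      rw [hβ] at this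
      rw [this]; push_cast; ring
  simp_rw [key, mul_add, Finset.sum_add_distrib]
  congr 1
  · symm
    apply Finset.sum_of_injOn (fun β => β + Pi.single i 1)
    · intro a _ b _ hab
      exact add_right_cancel hab
    · intro β hβ
      exact hle β hβ
    · intro β hβ hn
      split_ifs with h
      · rfl
      · exfalso
        apply hn
        refine ⟨β - Pi.single i 1, ?_, ?_⟩
        · rw [Finset.mem_coe, Finset.mem_Iic] at *
          exact tsub_le_iff_right.mpr hβ
        · funext j
          by_cases hj : j = i
          · subst hj; simp; omega
          · simp [hj]
    · intro β _
      simp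
  · symm
    apply Finset.sum_subset
    · apply Finset.Iic_subset_Iic.mpr
      exact le_self_add
    · intro β _ hβ
      rw [mChoose_eq_zero (by simpa using hβ)]
      simp

/-- The multi-index Leibniz rule. -/
lemma mderiv_mul {f g : Rd d → ℂ} (hf : ContDiff ℝ (⊤ : ℕ∞) f) (hg : ContDiff ℝ (⊤ : ℕ∞) g)
    (α : Fin d → ℕ) (x : Rd d) :
    mderiv α (f * g) x
      = ∑ β ∈ Finset.Iic α, (mChoose α β : ℂ) * (mderiv β f x * mderiv (α - β) g x) := by
  induction α using multiIndex_induction generalizing f g with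
  | h0 =>
    have : Finset.Iic (0 : Fin d → ℕ) = {0} := by
      ext β; simp
    simp [this, mderiv_zero, mChoose_zero]
  | hs α i ih =>
    rw [mderiv_add_single (f := f * g) (hf.mul hg), ← mderiv_pder (f := f * g) (hf.mul hg),
      pder_mul hf hg, mderiv_add (f := pder i f * g) (g := f * pder i g)
        ((contDiff_pder hf i).mul hg) (hf.mul (contDiff_pder hg i)), Pi.add_apply,
      ih (contDiff_pder hf i) hg, ih hf (contDiff_pder hg i), sum_mChoose_add_single,
      ← Finset.sum_add_distrib]
    refine Finset.sum_congr rfl fun β hβ => ?_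
    rw [← mul_add]
    have h1 : α + Pi.single i 1 - (β + Pi.single i 1) = α - β := by
      exact add_tsub_add_eq_tsub_right α _ β
    have h2 : α + Pi.single i 1 - β = (α - β) + Pi.single i 1 := by
      funext j
      have : β j ≤ α j := Finset.mem_Iic.mp hβ j
      simp only [Pi.sub_apply, Pi.add_apply]
      omega
    rw [h1, h2, mderiv_add_single hf, mderiv_add_single hg, mderiv_pder hf, mderiv_pder hg]

lemma eq_sum_single (v : Rd d) : v = ∑ i, v i • EuclideanSpace.single i (1 : ℝ) := by
  ext j
  simp [Pi.single_apply]

lemma norm_fderiv_le_sum_pder (f : Rd d → ℂ) (x : Rd d) :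
    ‖fderiv ℝ f x‖ ≤ ∑ i, ‖pder i f x‖ := by
  refine ContinuousLinearMap.opNorm_le_bound _ (Finset.sum_nonneg fun i _ => norm_nonneg _) ?_
  intro v
  conv_lhs => rw [eq_sum_single v, map_sum]
  rw [Finset.sum_mul]
  refine (norm_sum_le _ _).trans (Finset.sum_le_sum fun i _ => ?_)
  rw [map_smul, norm_smul, mul_comm]
  gcongr
  · rfl
  · exact PiLp.norm_apply_le v i

lemma contDiff_of_pder {f : Rd d → ℂ} (hf : Differentiable ℝ f) {m : ℕ}
    (h : ∀ i, ContDiff ℝ m (pder i f)) : ContDiff ℝ (m + 1 : ℕ) f := by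
  have : fderiv ℝ f = fun x => ∑ i, (EuclideanSpace.proj i : Rd d →L[ℝ] ℝ).smulRight (pder i f x) := by
    funext x
    ext v
    conv_lhs => rw [eq_sum_single v, map_sum]
    simp [pder]
  rw [Nat.cast_add, Nat.cast_one, contDiff_succ_iff_fderiv]
  refine ⟨hf, by simp, ?_⟩
  rw [this]
  refine ContDiff.sum fun i _ => ?_
  exact (ContinuousLinearMap.smulRightL ℝ (Rd d) ℂ (EuclideanSpace.proj i)).contDiff.comp (h i)

section Series

variable {ι : Type*} {ψ : ι → Rd d → ℂ} {v : (Fin d → ℕ) → ι → ℝ}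

lemma hasFDerivAt_tsum_of_mderiv_bound (hψ : ∀ n, ContDiff ℝ (⊤ : ℕ∞) (ψ n))
    (hv : ∀ α, Summable (v α)) (hb : ∀ α n x, ‖mderiv α (ψ n) x‖ ≤ v α n) (x : Rd d) :
    HasFDerivAt (fun y => ∑' n, ψ n y) (∑' n, fderiv ℝ (ψ n) x) x := by
  have h1 : ∀ n (i : Fin d), mderiv (Pi.single i 1) (ψ n) = pder i (ψ n) := by
    intro n i
    have := mderiv_add_single (hψ n) 0 i
    rwa [zero_add, mderiv_zero] at this
  refine hasFDerivAt_tsum (u := fun n => ∑ i, v (Pi.single i 1) n)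
    (summable_sum fun i _ => hv _)
    (fun n y => ((hψ n).differentiable (by simp) y).hasFDerivAt)
    (fun n y => (norm_fderiv_le_sum_pder _ _).trans (Finset.sum_le_sum fun i _ => ?_)) (x₀ := x) ?_ x
  · rw [← h1]; exact hb _ n y
  · refine Summable.of_norm_bounded (hv 0) fun n => ?_
    simpa [mderiv_zero] using hb 0 n x

lemma pder_tsum (hψ : ∀ n, ContDiff ℝ (⊤ : ℕ∞) (ψ n))
    (hv : ∀ α, Summable (v α)) (hb : ∀ α n x, ‖mderiv α (ψ n) x‖ ≤ v α n) (i : Fin d) :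
    pder i (fun y => ∑' n, ψ n y) = fun y => ∑' n, pder i (ψ n) y := by
  funext x
  rw [pder, (hasFDerivAt_tsum_of_mderiv_bound hψ hv hb x).fderiv]
  have hs : Summable fun n => fderiv ℝ (ψ n) x := by
    refine Summable.of_norm_bounded (summable_sum (s := Finset.univ) fun i _ => hv (Pi.single i 1))
      fun n => (norm_fderiv_le_sum_pder _ _).trans (Finset.sum_le_sum fun i _ => ?_)
    have := mderiv_add_single (hψ n) 0 i
    rw [zero_add, mderiv_zero] at this
    rw [← this]; exact hb _ n x
  exact (ContinuousLinearMap.apply ℝ ℂ (EuclideanSpace.single i (1 : ℝ) : Rd d)).map_tsum hs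

lemma mderiv_bound_pder (hψ : ∀ n, ContDiff ℝ (⊤ : ℕ∞) (ψ n))
    (hb : ∀ α n x, ‖mderiv α (ψ n) x‖ ≤ v α n) (i : Fin d) (α : Fin d → ℕ) (n : ι) (x : Rd d) :
    ‖mderiv α (pder i (ψ n)) x‖ ≤ v (α + Pi.single i 1) n := by
  rw [mderiv_pder (hψ n), ← mderiv_add_single (hψ n)]
  exact hb _ n x

lemma contDiff_tsum_of_mderiv_bound (hψ : ∀ n, ContDiff ℝ (⊤ : ℕ∞) (ψ n))
    (hv : ∀ α, Summable (v α)) (hb : ∀ α n x, ‖mderiv α (ψ n) x‖ ≤ v α n) :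
    ContDiff ℝ (⊤ : ℕ∞) (fun y => ∑' n, ψ n y) := by
  rw [contDiff_infty]
  intro m
  induction m generalizing ψ v with
  | zero =>
    rw [Nat.cast_zero, contDiff_zero]
    exact continuous_iff_continuousAt.mpr
      fun x => (hasFDerivAt_tsum_of_mderiv_bound hψ hv hb x).continuousAt
  | succ m ih =>
    refine contDiff_of_pder
      (fun x => (hasFDerivAt_tsum_of_mderiv_bound hψ hv hb x).differentiableAt) fun i => ?_
    rw [pder_tsum hψ hv hb]
    exact ih (fun n => contDiff_pder (hψ n) i) (fun α => hv (α + Pi.single i 1))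
      (mderiv_bound_pder hψ hb i)

lemma mderiv_tsum (hψ : ∀ n, ContDiff ℝ (⊤ : ℕ∞) (ψ n))
    (hv : ∀ α, Summable (v α)) (hb : ∀ α n x, ‖mderiv α (ψ n) x‖ ≤ v α n) (α : Fin d → ℕ) :
    mderiv α (fun y => ∑' n, ψ n y) = fun y => ∑' n, mderiv α (ψ n) y := by
  induction α using multiIndex_induction generalizing ψ v with
  | h0 => simp [mderiv_zero]
  | hs α i ih =>
    have hc := contDiff_tsum_of_mderiv_bound hψ hv hb
    rw [mderiv_add_single hc, ← mderiv_pder hc, pder_tsum hψ hv hb,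
      ih (fun n => contDiff_pder (hψ n) i) (fun α => hv (α + Pi.single i 1))
        (mderiv_bound_pder hψ hb i)]
    funext y
    exact tsum_congr fun n => by rw [mderiv_add_single (hψ n), mderiv_pder (hψ n)]

end Series

/-! ### Weight sequences -/

section Weight

variable {M : ℕ → ℝ}

lemma IsM1.ratio_le (hM : IsM1 M) (p q : ℕ) : M (q + 1) * M (p + q) ≤ M q * M (p + q + 1) := by
  induction p with
  | zero => simp [mul_comm]
  | succ p ih =>
    have h := hM.2 (p + q + 1) (by omega)
    rw [Nat.add_sub_cancel] at h
    have h1 := hM.1 (p + q)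
    have h2 := hM.1 (p + q + 1)
    have h3 := hM.1 q
    rw [show p + 1 + q = p + q + 1 by ring]
    have : M (p + q) * (M (q + 1) * M (p + q + 1)) ≤ M (p + q) * (M q * M (p + q + 1 + 1)) := by
      calc M (p + q) * (M (q + 1) * M (p + q + 1))
          = M (q + 1) * M (p + q) * M (p + q + 1) := by ring
        _ ≤ M q * M (p + q + 1) * M (p + q + 1) := by gcongr
        _ = M q * (M (p + q + 1)) ^ 2 := by ring
        _ ≤ M q * (M (p + q) * M (p + q + 1 + 1)) := by gcongr
        _ = _ := by ring
    exact le_of_mul_le_mul_left this h1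

lemma IsM1.mul_le (hM : IsM1 M) (p q : ℕ) : M p * M q ≤ M 0 * M (p + q) := by
  induction q with
  | zero => simp [mul_comm]
  | succ q ih =>
    have h := hM.ratio_le p q
    have h1 := hM.1 (p + q)
    have h2 := hM.1 q
    have h3 := hM.1 (q + 1)
    have : M q * (M p * M (q + 1)) ≤ M q * (M 0 * M (p + q + 1)) := by
      calc M q * (M p * M (q + 1)) = M p * M q * M (q + 1) := by ring
        _ ≤ M 0 * M (p + q) * M (q + 1) := by gcongr
        _ = M 0 * (M (q + 1) * M (p + q)) := by ring
        _ ≤ M 0 * (M q * M (p + q + 1)) := by gcongr; exact (hM.1 0).le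
        _ = _ := by ring
    exact le_of_mul_le_mul_left this h2

/-- A positive sequence with vanishing successive ratios is bounded. -/
lemma exists_le_of_ratio_tendsto_zero {x : ℕ → ℝ} (hx : ∀ n, 0 < x n)
    (h : Filter.Tendsto (fun n => x (n + 1) / x n) Filter.atTop (nhds 0)) :
    ∃ C > 0, ∀ n, x n ≤ C := by
  have hs : Summable x := by
    refine summable_of_ratio_test_tendsto_lt_one (l := 0) zero_lt_one
      (Filter.Eventually.of_forall fun n => (hx n).ne') ?_
    simpa [abs_of_pos (hx _)] using h
  refine ⟨∑' n, x n, hs.tsum_pos (fun n => (hx n).le) 0 (hx 0), fun n => ?_⟩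
  exact hs.le_tsum n fun j _ => (hx j).le

lemma exists_geometric_le (hM : IsM1 M) (hM3 : IsM3' M) {L : ℝ} (hL : 0 < L) :
    ∃ C > 0, ∀ p, L ^ p ≤ C * M p := by
  obtain ⟨C, hC, h⟩ := exists_le_of_ratio_tendsto_zero (x := fun p => L ^ p / M p)
    (fun p => div_pos (pow_pos hL p) (hM.1 p)) (by
      have : (fun n => L ^ (n + 1) / M (n + 1) / (L ^ n / M n)) = fun n => L * (M n / M (n + 1)) := by
        funext n
        have := (hM.1 n).ne'
        have := (hM.1 (n + 1)).ne'
        have := hL.ne'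
        field_simp
        ring
      rw [this]
      simpa using hM3.tendsto_atTop_zero.const_mul L)
  exact ⟨C, hC, fun p => (div_le_iff₀ (hM.1 p)).mp (h p)⟩

lemma IsM2'.shift (hM : IsM1 M) (hM2 : IsM2' M) (K : ℕ) :
    ∃ A H : ℝ, 1 ≤ A ∧ 1 ≤ H ∧ ∀ p, ∀ k ≤ K, M (p + k) ≤ A * H ^ p * M p := by
  obtain ⟨A, H, hA, hH, h⟩ := hM2
  induction K with
  | zero =>
    refine ⟨1, 1, le_rfl, le_rfl, fun p k hk => ?_⟩
    obtain rfl : k = 0 := by omega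
    simp
  | succ K ih =>
    obtain ⟨A', H', hA', hH', h'⟩ := ih
    have h1A : A' ≤ A * H ^ K * A' :=
      le_mul_of_one_le_left (by linarith) (one_le_mul_of_one_le_of_one_le hA (one_le_pow₀ hH))
    have h1H : H' ≤ H * H' := le_mul_of_one_le_left (by linarith) hH
    refine ⟨A * H ^ K * A', H * H', hA'.trans h1A, hH'.trans h1H, fun p k hk => ?_⟩
    rcases Nat.lt_or_ge k (K + 1) with hk' | hk'
    · refine (h' p k (by omega)).trans ?_
      have := (hM.1 p).le
      gcongr
    · obtain rfl : k = K + 1 := by omega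
      have := (hM.1 p).le
      have := (hM.1 (p + K)).le
      calc M (p + (K + 1)) ≤ A * H ^ (p + K) * M (p + K) := h (p + K)
        _ ≤ A * H ^ (p + K) * (A' * H' ^ p * M p) := by gcongr; exact h' p K le_rfl
        _ = A * H ^ K * A' * (H * H') ^ p * M p := by rw [pow_add, mul_pow]; ring

/-- Widths of the successive averagings that produce a bump function of class `(M_p)`. -/
lemma exists_widths (hM : IsM1 M) (hM3 : IsM3' M) :
    ∃ a : ℕ → ℝ, (∀ p, 0 < a p) ∧ Summable a ∧ ∑' p, a p ≤ 1 ∧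
      ∀ ε > (0 : ℝ), ∃ C > 0, ∀ n, ∏ j ∈ Finset.range n, (2 / a j) ≤ C * (ε ^ n * M n) := by
  set x : ℕ → ℝ := fun p => M p / M (p + 1) with hx
  have hx0 : ∀ p, 0 < x p := fun p => div_pos (hM.1 p) (hM.1 (p + 1))
  have hxs : Summable x := hM3
  set t : ℕ → ℝ := fun p => ∑' j, x (j + p) with ht
  have hts : ∀ p, Summable fun j => x (j + p) := fun p => (summable_nat_add_iff p).mpr hxs
  have ht0 : ∀ p, 0 < t p := fun p => (hts p).tsum_pos (fun j => (hx0 _).le) 0 (hx0 _)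
  have htr : ∀ p, t p = x p + t (p + 1) := by
    intro p
    simp only [ht]
    rw [(hts p).tsum_eq_zero_add]
    simp [add_assoc, add_comm 1 p]
  have htl : Filter.Tendsto t Filter.atTop (nhds 0) := tendsto_sum_nat_add x
  have hsq : ∀ p, 0 < √(t p) := fun p => Real.sqrt_pos.mpr (ht0 p)
  have hle : ∀ p, x p / √(t p) ≤ 2 * (√(t p) - √(t (p + 1))) := by
    intro p
    rw [div_le_iff₀ (hsq p)]
    have h1 := Real.sq_sqrt (ht0 p).le
    have h2 := Real.sq_sqrt (ht0 (p + 1)).le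
    have h3 := htr p
    nlinarith [sq_nonneg (√(t p) - √(t (p + 1)))]
  have hsum : ∀ n, ∑ p ∈ Finset.range n, x p / √(t p) / (2 * √(t 0)) ≤ 1 := by
    intro n
    rw [← Finset.sum_div, div_le_one (by have := hsq 0; positivity)]
    refine (Finset.sum_le_sum fun p _ => hle p).trans ?_
    rw [← Finset.mul_sum, Finset.sum_range_sub']
    have := (hsq n).le
    linarith
  have ha0 : ∀ p, 0 < x p / √(t p) / (2 * √(t 0)) := fun p => by
    have := hsq p; have := hsq 0; have := hx0 p; positivity
  refine ⟨fun p => x p / √(t p) / (2 * √(t 0)), ha0,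
    summable_of_sum_range_le (fun p => (ha0 p).le) hsum,
    Real.tsum_le_of_sum_range_le (fun p => (ha0 p).le) hsum, fun ε hε => ?_⟩
  obtain ⟨C, hC, h⟩ := exists_le_of_ratio_tendsto_zero
    (x := fun n => (∏ j ∈ Finset.range n, (4 * √(t 0) * √(t j))) / ε ^ n)
    (fun n => div_pos (Finset.prod_pos fun j _ => by have := hsq j; have := hsq 0; positivity)
      (pow_pos hε n)) (by
      have : (fun n => (∏ j ∈ Finset.range (n + 1), (4 * √(t 0) * √(t j))) / ε ^ (n + 1)
          / ((∏ j ∈ Finset.range n, (4 * √(t 0) * √(t j))) / ε ^ n))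
          = fun n => 4 * √(t 0) / ε * √(t n) := by
        funext n
        have : ∏ j ∈ Finset.range n, (4 * √(t 0) * √(t j)) ≠ 0 :=
          (Finset.prod_pos fun j _ => by have := hsq j; have := hsq 0; positivity).ne'
        rw [Finset.prod_range_succ]
        field_simp
        ring
      rw [this]
      have h0 : Filter.Tendsto (fun n => √(t n)) Filter.atTop (nhds 0) := by
        simpa [Function.comp_def] using (Real.continuous_sqrt.tendsto 0).comp htl
      simpa using h0.const_mul (4 * √(t 0) / ε))
  refine ⟨C / M 0, div_pos hC (hM.1 0), fun n => ?_⟩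
  have hprod : ∏ j ∈ Finset.range n, (2 / (x j / √(t j) / (2 * √(t 0))))
      = (∏ j ∈ Finset.range n, (4 * √(t 0) * √(t j))) * (M n / M 0) := by
    have htel : ∏ j ∈ Finset.range n, M (j + 1) / M j = M n / M 0 :=
      Finset.prod_range_induction _ (fun n => M n / M 0) (div_self (hM.1 0).ne') _ fun j _ => by
        have := (hM.1 0).ne'
        have := (hM.1 j).ne'
        field_simp
    rw [← htel, ← Finset.prod_mul_distrib]
    refine Finset.prod_congr rfl fun j _ => ?_
    have := (hM.1 j).ne'
    have := (hM.1 (j + 1)).ne'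
    have := (hsq j).ne'
    have := (hsq 0).ne'
    simp only [hx]
    field_simp
    norm_num
  rw [hprod]
  have h1 := (div_le_iff₀ (pow_pos hε n)).mp (h n)
  have h2 : 0 ≤ M n / M 0 := (div_pos (hM.1 n) (hM.1 0)).le
  calc _ ≤ C * ε ^ n * (M n / M 0) := by gcongr
    _ = _ := by ring

end Weight

/-! ### A one-dimensional partition of unity -/

/-- The average of `h` over `[t - a, t]`. -/
def slidingAvg (a : ℝ) (h : ℝ → ℝ) (t : ℝ) : ℝ := a⁻¹ * ∫ s in (0 : ℝ)..a, h (t - s)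

lemma slidingAvg_const_le {a : ℝ} (ha : 0 < a) {h : ℝ → ℝ} {t c : ℝ}
    (hc : ∀ s ∈ Set.Icc 0 a, |h (t - s)| ≤ c) : |slidingAvg a h t| ≤ c := by
  have := intervalIntegral.norm_integral_le_of_norm_le_const (a := 0) (b := a)
    (f := fun s => h (t - s)) (C := c) (fun s hs => hc s (by
      rw [Set.uIoc_of_le ha.le] at hs; exact ⟨hs.1.le, hs.2⟩))
  rw [slidingAvg, abs_mul, abs_of_pos (inv_pos.mpr ha)]
  rw [Real.norm_eq_abs, sub_zero, abs_of_pos ha] at this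
  rw [inv_mul_le_iff₀ ha]
  linarith

lemma slidingAvg_sub {a : ℝ} {h g : ℝ → ℝ} (hh : Continuous h) (hg : Continuous g) (t : ℝ) :
    slidingAvg a h t - slidingAvg a g t = slidingAvg a (fun s => h s - g s) t := by
  unfold slidingAvg
  rw [← mul_sub, intervalIntegral.integral_sub]
  · exact (hh.comp (continuous_const.sub continuous_id)).intervalIntegrable _ _
  · exact (hg.comp (continuous_const.sub continuous_id)).intervalIntegrable _ _

lemma slidingAvg_const {a : ℝ} (ha : 0 < a) (c t : ℝ) : slidingAvg a (fun _ => c) t = c := by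
  simp [slidingAvg, ha.ne']

lemma hasDerivAt_slidingAvg {a : ℝ} {h : ℝ → ℝ} (hh : Continuous h) (t : ℝ) :
    HasDerivAt (slidingAvg a h) ((h t - h (t - a)) / a) t := by
  have heq : slidingAvg a h = fun t => a⁻¹ * ((∫ s in (0 : ℝ)..t, h s) - ∫ s in (0 : ℝ)..(t - a), h s) := by
    funext t
    rw [slidingAvg, intervalIntegral.integral_comp_sub_left, sub_zero,
      intervalIntegral.integral_interval_sub_left (hh.intervalIntegrable _ _)
        (hh.intervalIntegrable _ _)]
  have h1 : ∀ t, HasDerivAt (fun t => ∫ s in (0 : ℝ)..t, h s) (h t) t := fun t =>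
    intervalIntegral.integral_hasDerivAt_right (hh.intervalIntegrable _ _)
      (hh.stronglyMeasurableAtFilter _ _) hh.continuousAt
  have h2 : HasDerivAt (fun t => ∫ s in (0 : ℝ)..(t - a), h s) (h (t - a)) t :=
    HasDerivAt.comp_sub_const t a (h1 (t - a))
  rw [heq, div_eq_inv_mul]
  exact ((h1 t).sub h2).const_mul _

/-- The hat function, whose integer translates sum to one. -/
def hat (t : ℝ) : ℝ := max 0 (1 - |t|)

lemma lipschitzWith_hat (s t : ℝ) : |hat s - hat t| ≤ |s - t| := by
  unfold hat
  have h1 := abs_sub_abs_le_abs_sub s t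
  have h2 := abs_sub_abs_le_abs_sub t s
  rw [abs_sub_comm t s] at h2
  refine (abs_max_sub_max_le_max 0 (1 - |s|) 0 (1 - |t|)).trans ?_
  simp only [sub_self, abs_zero]
  refine max_le (abs_nonneg _) ?_
  rw [abs_le]
  constructor <;> linarith

lemma continuous_hat : Continuous hat := by unfold hat; fun_prop

lemma abs_hat_le (t : ℝ) : |hat t| ≤ 1 := by
  unfold hat
  rw [abs_of_nonneg (le_max_left _ _)]
  exact max_le zero_le_one (by have := abs_nonneg t; linarith)

lemma hat_eq_zero {t : ℝ} (ht : 1 ≤ |t|) : hat t = 0 := max_eq_left (by linarith)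

lemma sum_hat {t : ℝ} {N : ℕ} (ht : |t| + 1 ≤ N) :
    ∑ k ∈ Finset.Icc (-(N : ℤ)) N, hat (t - k) = 1 := by
  have hf1 := Int.floor_le t
  have hf2 := Int.lt_floor_add_one t
  have ht1 := abs_le.mp (show |t| ≤ N - 1 by linarith)
  have hsub : ({⌊t⌋, ⌊t⌋ + 1} : Finset ℤ) ⊆ Finset.Icc (-(N : ℤ)) N := by
    intro k hk
    have hl : (-(N : ℤ)) ≤ ⌊t⌋ := Int.le_floor.mpr (by push_cast; linarith)
    have hr : ⌊t⌋ + 1 ≤ (N : ℤ) := by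
      have : (⌊t⌋ : ℝ) ≤ ((N - 1 : ℤ) : ℝ) := by push_cast; linarith
      have := Int.cast_le.mp this
      omega
    simp only [Finset.mem_insert, Finset.mem_singleton] at hk
    rw [Finset.mem_Icc]
    omega
  rw [← Finset.sum_subset hsub, Finset.sum_pair (by omega)]
  · unfold hat
    push_cast
    rw [abs_of_nonneg (by linarith), abs_of_nonpos (by linarith), max_eq_right (by linarith),
      max_eq_right (by linarith)]
    ring
  · intro k _ hk
    apply hat_eq_zero
    simp only [Finset.mem_insert, Finset.mem_singleton, not_or] at hk
    rcases lt_or_gt_of_ne hk.1 with h | h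
    · have : (k : ℝ) + 1 ≤ ⌊t⌋ := by exact_mod_cast h
      rw [abs_of_nonneg (by linarith)]
      linarith
    · have : ⌊t⌋ + 2 ≤ k := by omega
      have : (⌊t⌋ : ℝ) + 2 ≤ k := by exact_mod_cast this
      rw [abs_of_nonpos (by linarith)]
      linarith

/-- The hat function averaged over windows of widths `a p, …, a (p + n - 1)`. -/
def iterAvg (a : ℕ → ℝ) : ℕ → ℕ → ℝ → ℝ
  | 0, _ => hat
  | n + 1, p => slidingAvg (a p) (iterAvg a n (p + 1))

section IterAvg

variable {a : ℕ → ℝ}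

lemma continuous_iterAvg (n p : ℕ) : Continuous (iterAvg a n p) := by
  induction n generalizing p with
  | zero => exact continuous_hat
  | succ n ih =>
    exact continuous_iff_continuousAt.mpr fun t => (hasDerivAt_slidingAvg (ih (p + 1)) t).continuousAt

lemma sum_range_shift (n p : ℕ) :
    ∑ j ∈ Finset.range (n + 1), a (j + p) = a p + ∑ j ∈ Finset.range n, a (j + (p + 1)) := by
  rw [Finset.sum_range_succ', zero_add, add_comm]
  simp only [add_assoc, add_comm 1 p]

variable (ha : ∀ p, 0 < a p)
include ha

lemma iterAvg_lipschitz (n p : ℕ) (s t : ℝ) :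
    |iterAvg a n p s - iterAvg a n p t| ≤ |s - t| := by
  induction n generalizing p s t with
  | zero => exact lipschitzWith_hat s t
  | succ n ih =>
    have hc := continuous_iterAvg (a := a) n (p + 1)
    have h1 : iterAvg a (n + 1) p s
        = slidingAvg (a p) (fun r => iterAvg a n (p + 1) (r + (s - t))) t := by
      simp only [iterAvg, slidingAvg]
      congr 2
      funext r
      congr 1
      ring
    rw [h1]
    change |_ - slidingAvg (a p) (iterAvg a n (p + 1)) t| ≤ _
    rw [slidingAvg_sub (h := fun r => iterAvg a n (p + 1) (r + (s - t))) (by fun_prop) hc]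
    refine slidingAvg_const_le (ha p) fun r _ => (ih (p + 1) _ _).trans ?_
    rw [add_sub_cancel_left]

lemma abs_iterAvg_le (n p : ℕ) (t : ℝ) : |iterAvg a n p t| ≤ 1 := by
  induction n generalizing p t with
  | zero => exact abs_hat_le t
  | succ n ih => exact slidingAvg_const_le (ha p) fun r _ => ih (p + 1) _

lemma iterAvg_succ_sub (n p : ℕ) (t : ℝ) :
    |iterAvg a n p t - iterAvg a (n + 1) p t| ≤ a (n + p) := by
  induction n generalizing p t with
  | zero =>
    rw [← slidingAvg_const (ha p) (iterAvg a 0 p t) t]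
    simp only [iterAvg]
    rw [slidingAvg_sub continuous_const continuous_hat, zero_add]
    refine slidingAvg_const_le (ha p) fun r hr => (lipschitzWith_hat _ _).trans ?_
    rw [sub_sub_cancel, abs_of_nonneg hr.1]
    exact hr.2
  | succ n ih =>
    change |slidingAvg (a p) (iterAvg a n (p + 1)) t
      - slidingAvg (a p) (iterAvg a (n + 1) (p + 1)) t| ≤ _
    rw [slidingAvg_sub (continuous_iterAvg n _) (continuous_iterAvg (n + 1) _)]
    refine slidingAvg_const_le (ha p) fun r _ => (ih (p + 1) _).trans ?_
    rw [show n + (p + 1) = n + 1 + p by ring]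

lemma iterAvg_eq_zero (n p : ℕ) {t : ℝ}
    (ht : t ≤ -1 ∨ 1 + ∑ j ∈ Finset.range n, a (j + p) ≤ t) : iterAvg a n p t = 0 := by
  induction n generalizing p t with
  | zero =>
    apply hat_eq_zero
    rcases ht with h | h
    · rw [abs_of_nonpos (by linarith)]; linarith
    · simp only [Finset.range_zero, Finset.sum_empty, add_zero] at h
      rw [abs_of_nonneg (by linarith)]; exact h
  | succ n ih =>
    have : |iterAvg a (n + 1) p t| ≤ 0 := by
      refine slidingAvg_const_le (ha p) fun r hr => ?_
      rw [ih (p + 1), abs_zero]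
      rcases ht with h | h
      · left; linarith [hr.1]
      · right
        rw [sum_range_shift] at h
        linarith [hr.2]
    exact abs_eq_zero.mp (le_antisymm this (abs_nonneg _))

lemma sum_iterAvg (n p : ℕ) {t : ℝ} {N : ℕ}
    (ht : |t| + 1 + ∑ j ∈ Finset.range n, a (j + p) ≤ N) :
    ∑ k ∈ Finset.Icc (-(N : ℤ)) N, iterAvg a n p (t - k) = 1 := by
  induction n generalizing p t with
  | zero => exact sum_hat (by simpa using ht)
  | succ n ih =>
    have hc := continuous_iterAvg (a := a) n (p + 1)
    have h1 : ∑ k ∈ Finset.Icc (-(N : ℤ)) N, iterAvg a (n + 1) p (t - k)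
        = (a p)⁻¹ * ∫ s in (0 : ℝ)..a p,
            ∑ k ∈ Finset.Icc (-(N : ℤ)) N, iterAvg a n (p + 1) (t - s - k) := by
      rw [intervalIntegral.integral_finsetSum, Finset.mul_sum]
      · refine Finset.sum_congr rfl fun k _ => ?_
        simp only [iterAvg, slidingAvg]
        congr 2
        funext s
        congr 1
        ring
      · intro k _
        apply Continuous.intervalIntegrable
        fun_prop
    rw [h1, intervalIntegral.integral_congr (g := fun _ => (1 : ℝ))]
    · simp [(ha p).ne']
    · intro s hs
      rw [Set.uIcc_of_le (ha p).le] at hs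
      apply ih
      rw [sum_range_shift] at ht
      have : |t - s| ≤ |t| + a p := (abs_sub _ _).trans (by
        rw [abs_of_nonneg hs.1]; linarith [hs.2])
      linarith

/-- Infinitely iterated averaging of the hat function. -/
lemma exists_bump_system (has : Summable a) (ha1 : ∑' p, a p ≤ 1) :
    ∃ u : ℕ → ℝ → ℝ,
      (∀ p t, HasDerivAt (u p) ((u (p + 1) t - u (p + 1) (t - a p)) / a p) t) ∧
      (∀ p t, |u p t| ≤ 1) ∧
      (∀ t, t ≤ -1 ∨ 2 ≤ t → u 0 t = 0) ∧
      (∀ (t : ℝ) (N : ℕ), |t| + 2 ≤ N → ∑ k ∈ Finset.Icc (-(N : ℤ)) N, u 0 (t - k) = 1) := by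
  have hasp : ∀ p, Summable fun j => a (j + p) := fun p => (summable_nat_add_iff p).mpr has
  have hdist : ∀ p t n, dist (iterAvg a n p t) (iterAvg a n.succ p t) ≤ a (n + p) :=
    fun p t n => iterAvg_succ_sub ha n p t
  choose u hu using fun p t => cauchySeq_tendsto_of_complete
    (cauchySeq_of_dist_le_of_summable _ (hdist p t) (hasp p))
  have hpart : ∀ n, ∑ j ∈ Finset.range n, a (j + 0) ≤ 1 := fun n =>
    (has.sum_le_tsum _ fun j _ => (ha j).le).trans ha1
  have hlip : ∀ p s t, |u p s - u p t| ≤ |s - t| := fun p s t =>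
    le_of_tendsto ((hu p s).sub (hu p t)).abs
      (Filter.Eventually.of_forall fun n => iterAvg_lipschitz ha n p s t)
  have hcont : ∀ p, Continuous (u p) := fun p =>
    (LipschitzWith.of_dist_le_mul (K := 1) fun s t => by
      simpa [Real.dist_eq] using hlip p s t).continuous
  have herr : ∀ p t n, |iterAvg a n p t - u p t| ≤ ∑' m, a (m + (n + p)) := by
    intro p t n
    have := dist_le_tsum_of_dist_le_of_tendsto _ (hdist p t) (hasp p) (hu p t) n
    refine this.trans (le_of_eq (tsum_congr fun m => ?_))
    congr 1
    ring
  have hrec : ∀ p, u p = slidingAvg (a p) (u (p + 1)) := by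
    intro p
    funext t
    refine tendsto_nhds_unique ((Filter.tendsto_add_atTop_iff_nat 1).mpr (hu p t)) ?_
    rw [tendsto_iff_dist_tendsto_zero]
    have h0 : Filter.Tendsto (fun n => ∑' m, a (m + (n + (p + 1)))) Filter.atTop (nhds 0) :=
      (Filter.tendsto_add_atTop_iff_nat (p + 1)).mpr (tendsto_sum_nat_add a)
    refine squeeze_zero (fun n => dist_nonneg) (fun n => ?_) h0
    rw [Real.dist_eq]
    change |slidingAvg (a p) (iterAvg a n (p + 1)) t - _| ≤ _
    rw [slidingAvg_sub (continuous_iterAvg n _) (hcont _)]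
    exact slidingAvg_const_le (ha p) fun r _ => herr (p + 1) _ n
  refine ⟨u, fun p t => ?_, fun p t => ?_, fun t ht => ?_, fun t N hN => ?_⟩
  · rw [hrec p]
    exact hasDerivAt_slidingAvg (hcont _) t
  · exact le_of_tendsto (hu p t).abs (Filter.Eventually.of_forall fun n => abs_iterAvg_le ha n p t)
  · refine tendsto_nhds_unique (hu 0 t) ?_
    refine tendsto_const_nhds.congr fun n => (iterAvg_eq_zero ha n 0 ?_).symm
    exact ht.imp id fun h => by linarith [hpart n]
  · refine tendsto_nhds_unique (tendsto_finsetSum _ fun k _ => hu 0 (t - k)) ?_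
    refine tendsto_const_nhds.congr fun n => (sum_iterAvg ha n 0 ?_).symm
    linarith [hpart n]

end IterAvg

/-- Iterated difference quotients of a sequence of functions. -/
def diffQuot (a : ℕ → ℝ) (u : ℕ → ℝ → ℝ) : ℕ → ℕ → ℝ → ℝ
  | 0, p => u p
  | n + 1, p => fun t => (diffQuot a u n (p + 1) t - diffQuot a u n (p + 1) (t - a p)) / a p

/-- A bump function of class `(M_p)` on the line, given with all its derivatives `g n`, whose
integer translates form a partition of unity. -/
lemma exists_bump {M : ℕ → ℝ} (hM : IsM1 M) (hM3 : IsM3' M) :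
    ∃ g : ℕ → ℝ → ℝ, (∀ n t, HasDerivAt (g n) (g (n + 1) t) t) ∧
      (∀ n t, t < -1 ∨ 2 < t → g n t = 0) ∧
      (∀ ε > (0 : ℝ), ∃ C > 0, ∀ n t, |g n t| ≤ C * (ε ^ n * M n)) ∧
      (∀ (t : ℝ) (N : ℕ), |t| + 2 ≤ N → ∑ k ∈ Finset.Icc (-(N : ℤ)) N, g 0 (t - k) = 1) := by
  obtain ⟨a, ha, has, ha1, haM⟩ := exists_widths hM hM3
  obtain ⟨u, hu, hub, hu0, hup⟩ := exists_bump_system ha has ha1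
  have hder : ∀ n p t, HasDerivAt (diffQuot a u n p) (diffQuot a u (n + 1) p t) t := by
    intro n
    induction n with
    | zero => exact hu
    | succ n ih =>
      intro p t
      exact ((ih (p + 1) t).sub ((ih (p + 1) (t - a p)).comp_sub_const t (a p))).div_const _
  have hbd : ∀ n p t, |diffQuot a u n p t| ≤ ∏ j ∈ Finset.range n, (2 / a (j + p)) := by
    intro n
    induction n with
    | zero => intro p t; simpa [diffQuot] using hub p t
    | succ n ih =>
      intro p t
      rw [Finset.prod_range_succ', zero_add]
      simp only [diffQuot]
      rw [abs_div, abs_of_pos (ha p), mul_div_assoc', div_le_div_iff_of_pos_right (ha p), mul_two]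
      refine (abs_sub _ _).trans (add_le_add ?_ ?_) <;>
      · refine (ih (p + 1) _).trans (le_of_eq (Finset.prod_congr rfl fun j _ => ?_))
        rw [show j + (p + 1) = j + 1 + p by ring]
  refine ⟨fun n => diffQuot a u n 0, fun n => hder n 0, ?_, ?_, hup⟩
  · intro n
    have ho : IsOpen {t : ℝ | t < -1 ∨ 2 < t} := (isOpen_gt' (-1 : ℝ)).union (isOpen_lt' (2 : ℝ))
    induction n with
    | zero => intro t ht; exact hu0 t (ht.imp le_of_lt le_of_lt)
    | succ n ih =>
      intro t ht
      refine (hder n 0 t).unique ((hasDerivAt_const t (0 : ℝ)).congr_of_eventuallyEq ?_)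
      filter_upwards [ho.mem_nhds ht] with s hs using ih s hs
  · intro ε hε
    obtain ⟨C, hC, h⟩ := haM ε hε
    exact ⟨C, hC, fun n t => (hbd n 0 t).trans (h n)⟩

/-! ### Test functions -/

/-- The global bound `|∂^α φ| ≤ B ℓ^{|α|} M_{|α|}`. -/
def EBound (M : ℕ → ℝ) (ℓ B : ℝ) (φ : Rd d → ℂ) : Prop :=
  ∀ α x, ‖mderiv α φ x‖ ≤ B * (ℓ ^ mOrd α * M (mOrd α))

section TestFunctions

variable {M : ℕ → ℝ}

lemma isTestD_iff (hM : IsM1 M) {φ : Rd d → ℂ} :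
    IsTestD M φ ↔ ContDiff ℝ (⊤ : ℕ∞) φ ∧ HasCompactSupport φ ∧
      ∀ ℓ > (0 : ℝ), ∃ B, 0 ≤ B ∧ EBound M ℓ B φ := by
  refine and_congr_right fun hs => and_congr_right fun _ => forall₂_congr fun ℓ hℓ => ?_
  have hpos : ∀ p, 0 < ℓ ^ p * M p := fun p => mul_pos (pow_pos hℓ p) (hM.1 p)
  constructor
  · rintro ⟨b, hb⟩
    refine ⟨max b 0, le_max_right _ _, fun α x => ?_⟩
    by_cases hx : x ∈ tsupport φ
    · rw [← div_le_iff₀ (hpos _)]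
      exact (hb ⟨α, x, hx, rfl⟩).trans (le_max_left _ _)
    · rw [mderiv_eq_zero hs α hx, norm_zero]
      exact mul_nonneg (le_max_right _ _) (hpos _).le
  · rintro ⟨B, -, hB⟩
    refine ⟨B, ?_⟩
    rintro r ⟨α, x, -, rfl⟩
    rw [div_le_iff₀ (hpos _)]
    exact hB α x

lemma IsUltraD.exists_bound (hM : IsM1 M) {f : (Rd d → ℂ) →ₗ[ℂ] ℂ} (hf : IsUltraD M f)
    {K : Set (Rd d)} (hK : IsCompact K) :
    ∃ ℓ > (0 : ℝ), ∃ C > (0 : ℝ), ∀ (φ : Rd d → ℂ) (B : ℝ), IsTestD M φ → tsupport φ ⊆ K →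
      0 ≤ B → EBound M ℓ B φ → ‖f φ‖ ≤ C * B := by
  obtain ⟨ℓ, hℓ, C, hC, h⟩ := hf K hK
  refine ⟨ℓ, hℓ, C, hC, fun φ B hφ hsupp hB hb => (h φ hφ hsupp).trans ?_⟩
  gcongr
  refine Real.sSup_le ?_ hB
  rintro r ⟨α, x, -, rfl⟩
  rw [div_le_iff₀ (mul_pos (pow_pos hℓ _) (hM.1 _))]
  exact hb α x

lemma EBound.add {ℓ B₁ B₂ : ℝ} {φ ψ : Rd d → ℂ} (hφs : ContDiff ℝ (⊤ : ℕ∞) φ)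
    (hψs : ContDiff ℝ (⊤ : ℕ∞) ψ) (hφ : EBound M ℓ B₁ φ) (hψ : EBound M ℓ B₂ ψ) :
    EBound M ℓ (B₁ + B₂) (φ + ψ) := fun α x => by
  rw [mderiv_add hφs hψs, add_mul]
  exact (norm_add_le _ _).trans (add_le_add (hφ α x) (hψ α x))

lemma EBound.smul {ℓ B : ℝ} {φ : Rd d → ℂ} (hφs : ContDiff ℝ (⊤ : ℕ∞) φ)
    (hφ : EBound M ℓ B φ) (c : ℂ) : EBound M ℓ (‖c‖ * B) (c • φ) := fun α x => by
  rw [mderiv_smul hφs, Pi.smul_apply, norm_smul, mul_assoc]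
  gcongr
  exact hφ α x

lemma EBound.comp_sub {ℓ B : ℝ} {φ : Rd d → ℂ} (hφs : ContDiff ℝ (⊤ : ℕ∞) φ)
    (hφ : EBound M ℓ B φ) (h : Rd d) : EBound M ℓ B (fun x => φ (x - h)) := fun α x => by
  rw [mderiv_comp_sub hφs]
  exact hφ α _

lemma sum_mChoose (α : Fin d → ℕ) : ∑ β ∈ Finset.Iic α, (mChoose α β : ℝ) = 2 ^ mOrd α := by
  have : ∑ β ∈ Finset.Iic α, (mChoose α β : ℂ) = 2 ^ mOrd α := by
    induction α using multiIndex_induction with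
    | h0 =>
      have : Finset.Iic (0 : Fin d → ℕ) = {0} := by
        ext β; simp
      simp [this, mChoose_zero, mOrd_zero]
    | hs α i ih =>
      have := sum_mChoose_add_single α i fun _ => 1
      simp only [mul_one] at this
      rw [this, ← Finset.sum_mul, ih, mOrd_add, mOrd_single, pow_succ]
      norm_num
  exact_mod_cast this

lemma EBound.mul (hM : IsM1 M) {ε B₁ B₂ : ℝ} (hε : 0 < ε) (hB₁ : 0 ≤ B₁) (hB₂ : 0 ≤ B₂)
    {φ ψ : Rd d → ℂ} (hφs : ContDiff ℝ (⊤ : ℕ∞) φ) (hψs : ContDiff ℝ (⊤ : ℕ∞) ψ)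
    (hφ : EBound M ε B₁ φ) (hψ : EBound M ε B₂ ψ) :
    EBound M (2 * ε) (B₁ * B₂ * M 0) (φ * ψ) := fun α x => by
  rw [mderiv_mul hφs hψs]
  refine (norm_sum_le _ _).trans ?_
  have hle : ∀ β ∈ Finset.Iic α,
      ‖(mChoose α β : ℂ) * (mderiv β φ x * mderiv (α - β) ψ x)‖
        ≤ (mChoose α β : ℝ) * (B₁ * B₂ * (ε ^ mOrd α * (M 0 * M (mOrd α)))) := by
    intro β hβ
    have hα : mOrd α = mOrd β + mOrd (α - β) := by
      rw [← mOrd_add, add_tsub_cancel_of_le (Finset.mem_Iic.mp hβ)]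
    rw [norm_mul, norm_mul, Complex.norm_natCast]
    have h1 := (hM.1 (mOrd β)).le
    calc (mChoose α β : ℝ) * (‖mderiv β φ x‖ * ‖mderiv (α - β) ψ x‖)
        ≤ (mChoose α β : ℝ) * ((B₁ * (ε ^ mOrd β * M (mOrd β)))
            * (B₂ * (ε ^ mOrd (α - β) * M (mOrd (α - β))))) := by
          gcongr
          · exact hφ β x
          · exact hψ _ x
      _ = (mChoose α β : ℝ) * (B₁ * B₂ * (ε ^ (mOrd β + mOrd (α - β))
            * (M (mOrd β) * M (mOrd (α - β))))) := by rw [pow_add]; ring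
      _ ≤ _ := by
          rw [hα]
          gcongr _ * (_ * (_ * ?_))
          exact hM.mul_le _ _
  refine (Finset.sum_le_sum hle).trans (le_of_eq ?_)
  rw [← Finset.sum_mul, sum_mChoose, mul_pow]
  ring

lemma isTestD_add (hM : IsM1 M) {φ ψ : Rd d → ℂ} (hφ : IsTestD M φ) (hψ : IsTestD M ψ) :
    IsTestD M (φ + ψ) := by
  rw [isTestD_iff hM] at *
  refine ⟨hφ.1.add hψ.1, hφ.2.1.add hψ.2.1, fun ℓ hℓ => ?_⟩
  obtain ⟨B₁, hB₁, h₁⟩ := hφ.2.2 ℓ hℓ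
  obtain ⟨B₂, hB₂, h₂⟩ := hψ.2.2 ℓ hℓ
  exact ⟨B₁ + B₂, add_nonneg hB₁ hB₂, h₁.add hφ.1 hψ.1 h₂⟩

lemma isTestD_smul (hM : IsM1 M) {φ : Rd d → ℂ} (hφ : IsTestD M φ) (c : ℂ) :
    IsTestD M (c • φ) := by
  rw [isTestD_iff hM] at *
  refine ⟨contDiff_const.smul hφ.1, hφ.2.1.smul_left (f := fun _ => c), fun ℓ hℓ => ?_⟩
  obtain ⟨B, hB, h⟩ := hφ.2.2 ℓ hℓ
  exact ⟨‖c‖ * B, by positivity, h.smul hφ.1 c⟩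

lemma tsupport_comp_sub (φ : Rd d → ℂ) (h : Rd d) :
    tsupport (fun x => φ (x - h)) = {x | x - h ∈ tsupport φ} :=
  tsupport_comp_eq_preimage φ (Homeomorph.subRight h)

lemma isTestD_comp_sub (hM : IsM1 M) {φ : Rd d → ℂ} (hφ : IsTestD M φ) (h : Rd d) :
    IsTestD M (fun x => φ (x - h)) := by
  rw [isTestD_iff hM] at *
  refine ⟨hφ.1.comp (contDiff_id.sub contDiff_const),
    hφ.2.1.comp_homeomorph (Homeomorph.subRight h), fun ℓ hℓ => ?_⟩
  obtain ⟨B, hB, hb⟩ := hφ.2.2 ℓ hℓ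
  exact ⟨B, hB, hb.comp_sub hφ.1 h⟩

lemma isTestD_mul (hM : IsM1 M) {χ φ : Rd d → ℂ} (hχ : ContDiff ℝ (⊤ : ℕ∞) χ)
    (hχb : ∀ ε > (0 : ℝ), ∃ B, 0 ≤ B ∧ EBound M ε B χ) (hφ : IsTestD M φ) :
    IsTestD M (χ * φ) := by
  rw [isTestD_iff hM] at *
  refine ⟨hχ.mul hφ.1, hφ.2.1.mul_left, fun ℓ hℓ => ?_⟩
  obtain ⟨B₁, hB₁, h₁⟩ := hχb (ℓ / 2) (by positivity)
  obtain ⟨B₂, hB₂, h₂⟩ := hφ.2.2 (ℓ / 2) (by positivity)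
  have := h₁.mul hM (by positivity) hB₁ hB₂ hχ hφ.1 h₂
  rw [mul_div_cancel₀ _ two_ne_zero] at this
  exact ⟨_, mul_nonneg (mul_nonneg hB₁ hB₂) (hM.1 0).le, this⟩

end TestFunctions

lemma summable_pow_mOrd {r : ℝ} (hr0 : 0 ≤ r) (hr1 : r < 1) :
    Summable fun α : Fin d → ℕ => r ^ mOrd α := by
  refine summable_of_sum_le (c := ∏ _i : Fin d, (1 - r)⁻¹) (fun α => by positivity) fun s => ?_
  set N := s.sup mOrd with hN
  have hsub : s ⊆ Fintype.piFinset fun _ : Fin d => Finset.range (N + 1) := by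
    intro α hα
    rw [Fintype.mem_piFinset]
    intro i
    rw [Finset.mem_range, Nat.lt_succ_iff]
    exact (Finset.single_le_sum (f := α) (fun _ _ => Nat.zero_le _) (Finset.mem_univ i)).trans
      (Finset.le_sup (f := mOrd) hα)
  calc ∑ α ∈ s, r ^ mOrd α
      ≤ ∑ α ∈ Fintype.piFinset fun _ : Fin d => Finset.range (N + 1), r ^ mOrd α :=
        Finset.sum_le_sum_of_subset_of_nonneg hsub fun _ _ _ => by positivity
    _ = ∏ _i : Fin d, ∑ n ∈ Finset.range (N + 1), r ^ n := by
        rw [Finset.prod_univ_sum]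
        exact Finset.sum_congr rfl fun α _ => (Finset.prod_pow_eq_pow_sum _ _ _).symm
    _ ≤ _ := by
        refine Finset.prod_le_prod (fun _ _ => by positivity) fun _ _ => ?_
        rw [← tsum_geometric_of_lt_one hr0 hr1]
        exact (summable_geometric_of_lt_one hr0 hr1).sum_le_tsum _ fun _ _ => by positivity

/-! ### The partition of unity on `ℝ^d` -/

/-- The lattice point with integer coordinates `k`. -/
def lattice (k : Fin d → ℤ) : Rd d := WithLp.toLp 2 fun i => (k i : ℝ)

/-- The tensor product of the one-dimensional functions `g (α i)`. -/
def tensorFn (g : ℕ → ℝ → ℝ) (α : Fin d → ℕ) (x : Rd d) : ℂ := ∏ i, ((g (α i) (x i) : ℝ) : ℂ)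

section Tensor

variable {g : ℕ → ℝ → ℝ} (hg : ∀ n t, HasDerivAt (g n) (g (n + 1) t) t)
include hg

lemma contDiff_of_hasDerivAt_succ (n : ℕ) : ContDiff ℝ (⊤ : ℕ∞) (g n) := by
  rw [contDiff_infty]
  intro m
  induction m generalizing n with
  | zero =>
    exact contDiff_zero.mpr (continuous_iff_continuousAt.mpr fun t => (hg n t).continuousAt)
  | succ m ih =>
    rw [Nat.cast_add, Nat.cast_one, contDiff_succ_iff_deriv]
    refine ⟨fun t => (hg n t).differentiableAt, by simp, ?_⟩
    rw [show deriv (g n) = g (n + 1) from funext fun t => (hg n t).deriv]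
    exact ih (n + 1)

lemma contDiff_tensorFn (α : Fin d → ℕ) : ContDiff ℝ (⊤ : ℕ∞) (tensorFn g α) := by
  refine contDiff_prod fun i _ => ?_
  exact Complex.ofRealCLM.contDiff.comp ((contDiff_of_hasDerivAt_succ hg (α i)).comp
    (EuclideanSpace.proj i : Rd d →L[ℝ] ℝ).contDiff)

lemma pder_tensorFn (α : Fin d → ℕ) (i : Fin d) :
    pder i (tensorFn g α) = tensorFn g (α + Pi.single i 1) := by
  funext x
  have h1 : HasDerivAt (fun t : ℝ => tensorFn g α (x + t • EuclideanSpace.single i (1 : ℝ)))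
      (pder i (tensorFn g α) x) 0 :=
    (((contDiff_tensorFn hg α).differentiable (by simp) x).hasFDerivAt).hasLineDerivAt _
  have h2 : (fun t : ℝ => tensorFn g α (x + t • EuclideanSpace.single i (1 : ℝ)))
      = fun t : ℝ => ((g (α i) (x i + t) : ℝ) : ℂ)
        * ∏ j ∈ Finset.univ.erase i, ((g (α j) (x j) : ℝ) : ℂ) := by
    funext t
    rw [tensorFn, ← Finset.mul_prod_erase _ _ (Finset.mem_univ i)]
    congr 1
    · simp
    · refine Finset.prod_congr rfl fun j hj => ?_
      simp [(Finset.mem_erase.mp hj).1]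
  have h3 : HasDerivAt (fun t : ℝ => ((g (α i) (x i + t) : ℝ) : ℂ)
        * ∏ j ∈ Finset.univ.erase i, ((g (α j) (x j) : ℝ) : ℂ))
      (((g (α i + 1) (x i) : ℝ) : ℂ) * ∏ j ∈ Finset.univ.erase i, ((g (α j) (x j) : ℝ) : ℂ)) 0 := by
    have h4 : HasDerivAt (fun t : ℝ => g (α i) (x i + t)) (g (α i + 1) (x i)) 0 := by
      have := (hg (α i) (x i + 0)).comp_const_add (x i) 0
      rwa [add_zero] at this
    exact h4.ofReal_comp.mul_const _
  rw [h2] at h1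
  rw [h1.unique h3, tensorFn, ← Finset.mul_prod_erase _ _ (Finset.mem_univ i)]
  congr 1
  · simp
  · refine Finset.prod_congr rfl fun j hj => ?_
    simp [(Finset.mem_erase.mp hj).1]

lemma mderiv_tensorFn (α : Fin d → ℕ) : mderiv α (tensorFn g 0) = tensorFn g α := by
  induction α using multiIndex_induction with
  | h0 => exact mderiv_zero _
  | hs α i ih => rw [mderiv_add_single (contDiff_tensorFn hg 0), ih, pder_tensorFn hg]

end Tensor

lemma prod_weight_le {M : ℕ → ℝ} (hM : IsM1 M) (α : Fin d → ℕ) (s : Finset (Fin d)) :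
    (∏ i ∈ s, M (α i)) * M 0 ≤ M 0 ^ s.card * M (∑ i ∈ s, α i) := by
  induction s using Finset.induction_on with
  | empty => simp
  | insert a s ha ih =>
    rw [Finset.prod_insert ha, Finset.card_insert_of_notMem ha, Finset.sum_insert ha]
    have h0 := (hM.1 0).le
    calc M (α a) * (∏ i ∈ s, M (α i)) * M 0 = M (α a) * ((∏ i ∈ s, M (α i)) * M 0) := by ring
      _ ≤ M (α a) * (M 0 ^ s.card * M (∑ i ∈ s, α i)) := by gcongr; exact (hM.1 _).le
      _ = M 0 ^ s.card * (M (α a) * M (∑ i ∈ s, α i)) := by ring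
      _ ≤ M 0 ^ s.card * (M 0 * M (α a + ∑ i ∈ s, α i)) := by gcongr _ * ?_; exact hM.mul_le _ _
      _ = _ := by ring

/-- A function of class `(M_p)` supported in a cube whose lattice translates sum to one. -/
lemma exists_partition {M : ℕ → ℝ} (hM : IsM1 M) (hM3 : IsM3' M) :
    ∃ χ : Rd d → ℂ, ContDiff ℝ (⊤ : ℕ∞) χ ∧
      tsupport χ ⊆ {x | ∀ i, x i ∈ Set.Icc (-1 : ℝ) 2} ∧
      (∀ ε > (0 : ℝ), ∃ B, 0 ≤ B ∧ EBound M ε B χ) ∧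
      ∀ (x : Rd d) (N : ℕ), (∀ i, |x i| + 2 ≤ N) →
        ∑ k ∈ Fintype.piFinset fun _ : Fin d => Finset.Icc (-(N : ℤ)) N, χ (x - lattice k) = 1 := by
  obtain ⟨g, hg, hg0, hgb, hg1⟩ := exists_bump hM hM3
  refine ⟨tensorFn g 0, contDiff_tensorFn hg 0, ?_, fun ε hε => ?_, fun x N hN => ?_⟩
  · refine closure_minimal (fun x hx i => ?_) ?_
    · by_contra hxi
      rw [Set.mem_Icc, not_and_or, not_le, not_le] at hxi
      refine hx (Finset.prod_eq_zero (Finset.mem_univ i) ?_)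
      rw [hg0 _ _ hxi, Complex.ofReal_zero]
    · simp only [Set.ofPred_forall]
      exact isClosed_iInter fun i => isClosed_Icc.preimage (by fun_prop)
  · obtain ⟨C, hC, h⟩ := hgb ε hε
    have h0 := hM.1 0
    refine ⟨C ^ d * (M 0 ^ d / M 0), by positivity, fun α x => ?_⟩
    rw [mderiv_tensorFn hg, tensorFn, norm_prod]
    have hw := prod_weight_le hM α Finset.univ
    rw [Finset.card_univ, Fintype.card_fin, ← le_div_iff₀ h0] at hw
    calc ∏ i, ‖((g (α i) (x i) : ℝ) : ℂ)‖ ≤ ∏ i, (C * (ε ^ α i * M (α i))) := by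
          refine Finset.prod_le_prod (fun _ _ => norm_nonneg _) fun i _ => ?_
          rw [Complex.norm_real]
          exact h _ _
      _ = C ^ d * (ε ^ mOrd α * ∏ i, M (α i)) := by
          rw [Finset.prod_mul_distrib, Finset.prod_mul_distrib, Finset.prod_pow_eq_pow_sum]
          simp [mOrd]
      _ ≤ C ^ d * (ε ^ mOrd α * (M 0 ^ d * M (mOrd α) / M 0)) := by
          gcongr
          exact hw
      _ = _ := by ring
  · have : ∀ i, ∑ k ∈ Finset.Icc (-(N : ℤ)) N, ((g 0 (x i - k) : ℝ) : ℂ) = 1 := fun i => by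
      rw [← Complex.ofReal_sum, hg1 _ _ (hN i), Complex.ofReal_one]
    calc _ = ∏ i, ∑ k ∈ Finset.Icc (-(N : ℤ)) N, ((g 0 (x i - k) : ℝ) : ℂ) := by
          rw [Finset.prod_univ_sum]
          rfl
      _ = 1 := Finset.prod_eq_one fun i _ => this i

/-! ### Uniform boundedness of the translates -/

lemma l1_summable_norm (c : lp (fun _ : ℕ => ℂ) 1) : Summable fun n => ‖c n‖ := by
  simpa using (lp.memℓp c).summable (by norm_num)

lemma l1_norm_eq (c : lp (fun _ : ℕ => ℂ) 1) : ‖c‖ = ∑' n, ‖c n‖ := by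
  simpa using lp.norm_eq_tsum_rpow (by norm_num) c

section UniformBound

variable {M : ℕ → ℝ}

/-- A sequence of functions with constants tending to zero is bounded in the Beurling class. -/
lemma exists_uniform_EBound (hM : IsM1 M) {φ : ℕ → Rd d → ℂ} (hφ : ∀ n, IsTestD M (φ n))
    (hb : ∀ n : ℕ, EBound M (1 / ((n : ℝ) + 1)) 1 (φ n)) {ℓ : ℝ} (hℓ : 0 < ℓ) :
    ∃ B, 0 ≤ B ∧ ∀ n, EBound M ℓ B (φ n) := by
  choose B hB0 hB using fun n => ((isTestD_iff hM).mp (hφ n)).2.2 ℓ hℓ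
  obtain ⟨N, hN⟩ := exists_nat_one_div_lt hℓ
  refine ⟨1 + ∑ n ∈ Finset.range N, B n,
    add_nonneg zero_le_one (Finset.sum_nonneg fun n _ => hB0 n), fun n α x => ?_⟩
  have hMα := (hM.1 (mOrd α)).le
  rcases lt_or_ge n N with hn | hn
  · refine (hB n α x).trans ?_
    gcongr
    have := Finset.single_le_sum (f := B) (fun i _ => hB0 i) (Finset.mem_range.mpr hn)
    linarith
  · refine (hb n α x).trans ?_
    have h1 : 0 ≤ ∑ n ∈ Finset.range N, B n := Finset.sum_nonneg fun n _ => hB0 n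
    have h2 : 1 / ((n : ℝ) + 1) ≤ ℓ := by
      refine le_trans ?_ hN.le
      gcongr
    gcongr
    linarith

section Superposition

variable {φ : ℕ → Rd d → ℂ} (hφ : ∀ n, ContDiff ℝ (⊤ : ℕ∞) (φ n)) {ℓ B : ℝ}
  (hb : ∀ n, EBound M ℓ B (φ n))
include hφ hb

lemma norm_mderiv_smul_le (c : ℕ → ℂ) (α : Fin d → ℕ) (n : ℕ) (x : Rd d) :
    ‖mderiv α (c n • φ n) x‖ ≤ ‖c n‖ * (B * (ℓ ^ mOrd α * M (mOrd α))) := by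
  rw [mderiv_smul (hφ n), Pi.smul_apply, norm_smul]
  gcongr
  exact hb n α x

lemma contDiff_superposition {c : ℕ → ℂ} (hc : Summable fun n => ‖c n‖) :
    ContDiff ℝ (⊤ : ℕ∞) (fun x => ∑' n, (c n • φ n) x) :=
  contDiff_tsum_of_mderiv_bound (fun n => contDiff_const.smul (hφ n))
    (fun _ => hc.mul_right _) (fun α n x => norm_mderiv_smul_le hφ hb c α n x)

lemma EBound_superposition {c : ℕ → ℂ} (hc : Summable fun n => ‖c n‖) :
    EBound M ℓ (B * ∑' n, ‖c n‖) (fun x => ∑' n, (c n • φ n) x) := by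
  intro α x
  rw [mderiv_tsum (ψ := fun n => c n • φ n) (fun n => contDiff_const.smul (hφ n))
    (fun _ => hc.mul_right _) (fun α n x => norm_mderiv_smul_le hφ hb c α n x)]
  refine (tsum_of_norm_bounded (hc.hasSum.mul_right _)
    fun n => norm_mderiv_smul_le hφ hb c α n x).trans (le_of_eq ?_)
  ring

lemma summable_superposition {c : ℕ → ℂ} (hc : Summable fun n => ‖c n‖) (x : Rd d) :
    Summable fun n => (c n • φ n) x := by
  refine Summable.of_norm_bounded (hc.mul_right (B * (ℓ ^ mOrd (0 : Fin d → ℕ)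
    * M (mOrd (0 : Fin d → ℕ))))) fun n => ?_
  have := norm_mderiv_smul_le hφ hb c 0 n x
  rwa [mderiv_zero] at this

end Superposition

lemma isCompact_translate {K : Set (Rd d)} (hK : IsCompact K) (h : Rd d) :
    IsCompact {x | x - h ∈ K} :=
  (Homeomorph.subRight h).isCompact_preimage.mpr hK

/-- Pointwise boundedness of the translates of an ultradistribution is uniform on bounded sets of
test functions, and hence on a neighbourhood of zero. -/
lemma exists_translate_bound (hM : IsM1 M) {f : (Rd d → ℂ) →ₗ[ℂ] ℂ} (hf : IsUltraD M f)
    {W : Set (Rd d)} {ω : Rd d → ℝ} (hω : ∀ x, 0 < ω x)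
    (hbd : ∀ φ : Rd d → ℂ, IsTestD M φ → ∃ C : ℝ, ∀ h ∈ W, ‖f (fun x => φ (x - h))‖ ≤ C * ω h)
    {K : Set (Rd d)} (hK : IsCompact K) :
    ∃ ℓ > (0 : ℝ), ∃ C > (0 : ℝ), ∀ h ∈ W, ∀ (φ : Rd d → ℂ) (B : ℝ), IsTestD M φ →
      tsupport φ ⊆ K → 0 ≤ B → EBound M ℓ B φ → ‖f (fun x => φ (x - h))‖ ≤ C * ω h * B := by
  by_contra hcon
  push Not at hcon
  have key : ∀ n : ℕ, ∃ h ∈ W, ∃ φ : Rd d → ℂ, IsTestD M φ ∧ tsupport φ ⊆ K ∧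
      EBound M (1 / ((n : ℝ) + 1)) 1 φ ∧ ((n : ℝ) + 1) * ω h < ‖f (fun x => φ (x - h))‖ := by
    intro n
    obtain ⟨h, hh, φ, B, hφ, hφK, hB, hφB, hlt⟩ :=
      hcon (1 / ((n : ℝ) + 1)) (by positivity) ((n : ℝ) + 1) (by positivity)
    have hBpos : 0 < B := by
      refine lt_of_le_of_ne hB fun h0 => ?_
      have hzero : (fun x => φ (x - h)) = 0 := by
        funext x
        have := hφB 0 (x - h)
        rw [← h0, zero_mul, mderiv_zero] at this
        exact norm_le_zero_iff.mp this
      rw [hzero, ← h0] at hlt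
      simp at hlt
    have hnorm : ‖((B⁻¹ : ℝ) : ℂ)‖ = B⁻¹ := by
      rw [Complex.norm_real, Real.norm_of_nonneg (inv_nonneg.mpr hB)]
    refine ⟨h, hh, ((B⁻¹ : ℝ) : ℂ) • φ, isTestD_smul hM hφ _,
      (closure_mono (Function.support_const_smul_subset _ φ)).trans hφK, ?_, ?_⟩
    · have := hφB.smul hφ.1 ((B⁻¹ : ℝ) : ℂ)
      rwa [hnorm, inv_mul_cancel₀ hBpos.ne'] at this
    · change _ < ‖f (((B⁻¹ : ℝ) : ℂ) • fun x => φ (x - h))‖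
      rw [map_smul, norm_smul, hnorm, lt_inv_mul_iff₀ hBpos]
      linarith
  choose h hh φ hφ hφK hφb hlt using key
  have hφs : ∀ n, ContDiff ℝ (⊤ : ℕ∞) (φ n) := fun n => (hφ n).1
  have hφ1 : ∀ n, EBound M 1 1 (φ n) := fun n α x => (hφb n α x).trans (by
    have := (hM.1 (mOrd α)).le
    gcongr
    rw [div_le_one (by positivity)]
    linarith [n.cast_nonneg (α := ℝ)])
  let S : lp (fun _ : ℕ => ℂ) 1 → Rd d → ℂ := fun c x => ∑' n, (c n • φ n) x
  have hSK : ∀ c, tsupport (S c) ⊆ K := fun c => closure_minimal (fun x hx => by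
    by_contra hxK
    refine hx ?_
    have : ∀ n, φ n x = 0 := fun n => image_eq_zero_of_notMem_tsupport fun h => hxK (hφK n h)
    simp [S, this]) hK.isClosed
  have hS : ∀ c, IsTestD M (S c) := fun c => by
    rw [isTestD_iff hM]
    refine ⟨contDiff_superposition hφs hφ1 (l1_summable_norm c),
      hK.of_isClosed_subset (isClosed_tsupport _) (hSK c), fun ℓ hℓ => ?_⟩
    obtain ⟨B, hB, hb⟩ := exists_uniform_EBound hM hφ hφb hℓ
    exact ⟨_, mul_nonneg hB (tsum_nonneg fun n => norm_nonneg _),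
      EBound_superposition hφs hb (l1_summable_norm c)⟩
  let T : Rd d → lp (fun _ : ℕ => ℂ) 1 →ₗ[ℂ] ℂ := fun h =>
    { toFun := fun c => f (fun x => S c (x - h)) / ω h
      map_add' := fun c c' => by
        rw [← add_div, ← map_add]
        congr 2
        funext x
        simp only [S, Pi.add_apply]
        rw [← (summable_superposition hφs hφ1 (l1_summable_norm c) _).tsum_add
          (summable_superposition hφs hφ1 (l1_summable_norm c') _)]
        refine tsum_congr fun n => ?_
        simp [add_mul]
      map_smul' := fun r c => by
        rw [RingHom.id_apply, smul_eq_mul, ← mul_div_assoc, ← smul_eq_mul, ← map_smul]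
        congr 2
        funext x
        simp only [S, Pi.smul_apply]
        rw [← tsum_const_smul'']
        refine tsum_congr fun n => ?_
        simp [mul_assoc] }
  have hT : ∀ h, ∃ C, ∀ c, ‖T h c‖ ≤ C * ‖c‖ := by
    intro h
    obtain ⟨ℓ, hℓ, C, hC, hfb⟩ := hf.exists_bound hM (isCompact_translate hK h)
    obtain ⟨B, hB, hb⟩ := exists_uniform_EBound hM hφ hφb hℓ
    refine ⟨C * B / ω h, fun c => ?_⟩
    have h1 := hfb _ _ (isTestD_comp_sub hM (hS c) h)
      (by rw [tsupport_comp_sub]; exact fun x hx => hSK c hx)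
      (mul_nonneg hB (tsum_nonneg fun n => norm_nonneg _))
      ((EBound_superposition hφs hb (l1_summable_norm c)).comp_sub (hS c).1 h)
    change ‖f (fun x => S c (x - h)) / ω h‖ ≤ _
    rw [norm_div, Complex.norm_real, Real.norm_of_nonneg (hω h).le, l1_norm_eq,
      div_mul_eq_mul_div, div_le_div_iff_of_pos_right (hω h), mul_assoc]
    exact h1
  choose C hC using hT
  obtain ⟨C', hC'⟩ := banach_steinhaus (g := fun h : W => (T h).mkContinuous (C h) (hC h)) (by
    intro c
    obtain ⟨A, hA⟩ := hbd (S c) (hS c)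
    refine ⟨A, fun h => ?_⟩
    change ‖f (fun x => S c (x - h)) / ω h‖ ≤ _
    rw [norm_div, Complex.norm_real, Real.norm_of_nonneg (hω _).le, div_le_iff₀ (hω _)]
    exact hA h h.2)
  obtain ⟨n, hn⟩ := exists_nat_gt C'
  have h1 := ((T (h n)).mkContinuous (C (h n)) (hC (h n))).le_of_opNorm_le
    (hC' ⟨h n, hh n⟩) (lp.single 1 n 1)
  have h2 : S (lp.single 1 n 1) = φ n := by
    funext x
    simp only [S]
    rw [tsum_eq_single n]
    · simp
    · intro m hm
      simp [hm]
  rw [lp.norm_single (by norm_num)] at h1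
  change ‖f (fun x => S (lp.single 1 n 1) (x - h n)) / ω (h n)‖ ≤ _ at h1
  rw [h2, norm_div, Complex.norm_real, Real.norm_of_nonneg (hω _).le, div_le_iff₀ (hω _),
    norm_one, mul_one] at h1
  have h3 := (hlt n).trans_le h1
  have h4 := lt_of_mul_lt_mul_right h3 (hω _).le
  linarith

end UniformBound

/-! ### The Fourier weight -/

/-- The monomial `(2πξ)^α`. -/
def fourierMonomial (α : Fin d → ℕ) (ξ : Rd d) : ℝ := ∏ i, (2 * π * ξ i) ^ α i

lemma abs_fourierMonomial_le (α : Fin d → ℕ) (ξ : Rd d) :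
    |fourierMonomial α ξ| ≤ (2 * π * ‖ξ‖) ^ mOrd α := by
  rw [fourierMonomial, Finset.abs_prod, mOrd, ← Finset.prod_pow_eq_pow_sum]
  refine Finset.prod_le_prod (fun _ _ => abs_nonneg _) fun i _ => ?_
  rw [abs_pow, abs_mul, abs_of_pos Real.two_pi_pos]
  gcongr
  exact PiLp.norm_apply_le ξ i

lemma continuous_fourierMonomial (α : Fin d → ℕ) : Continuous (fourierMonomial α) := by
  unfold fourierMonomial
  fun_prop

lemma fourierMonomial_single (i : Fin d) (n : ℕ) (ξ : Rd d) :
    fourierMonomial (Pi.single i n) ξ = (2 * π * ξ i) ^ n := by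
  rw [fourierMonomial, Finset.prod_eq_single i]
  · simp
  · intro j _ hj
    simp [hj]
  · simp

/-- The coefficients `1 / (L^{|α|} M_{|α|})`, restricted to multi-indices with even entries. -/
def evenCoeff (M : ℕ → ℝ) (L : ℝ) (α : Fin d → ℕ) : ℝ :=
  open Classical in if ∀ i, Even (α i) then (L ^ mOrd α * M (mOrd α))⁻¹ else 0

/-- The weight `∑_α (2πξ)^α / (L^{|α|} M_{|α|})`, summed over even multi-indices. -/
def fourierWeight (M : ℕ → ℝ) (L : ℝ) (ξ : Rd d) : ℝ :=
  ∑' α, evenCoeff M L α * fourierMonomial α ξ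

section Weight

variable {M : ℕ → ℝ} (hM : IsM1 M) {L : ℝ} (hL : 0 < L)
include hM hL

lemma evenCoeff_nonneg (α : Fin d → ℕ) : 0 ≤ evenCoeff M L α := by
  rw [evenCoeff]
  split_ifs
  · exact inv_nonneg.mpr (mul_nonneg (pow_nonneg hL.le _) (hM.1 _).le)
  · rfl

lemma evenCoeff_le (α : Fin d → ℕ) : evenCoeff M L α ≤ (L ^ mOrd α * M (mOrd α))⁻¹ := by
  rw [evenCoeff]
  split_ifs
  · rfl
  · exact inv_nonneg.mpr (mul_nonneg (pow_nonneg hL.le _) (hM.1 _).le)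

lemma evenCoeff_mul_fourierMonomial_nonneg (α : Fin d → ℕ) (ξ : Rd d) :
    0 ≤ evenCoeff M L α * fourierMonomial α ξ := by
  by_cases h : ∀ i, Even (α i)
  · exact mul_nonneg (evenCoeff_nonneg hM hL α)
      (Finset.prod_nonneg fun i _ => (h i).pow_nonneg _)
  · rw [evenCoeff, if_neg h, zero_mul]

lemma summable_fourierWeight (hM3 : IsM3' M) (ξ : Rd d) :
    Summable fun α => evenCoeff M L α * fourierMonomial α ξ := by
  set t := 2 * π * ‖ξ‖ / L with ht
  have ht0 : 0 ≤ t := by positivity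
  obtain ⟨C, hC, hCM⟩ := exists_geometric_le hM hM3 (L := 2 * t + 1) (by positivity)
  refine Summable.of_nonneg_of_le (evenCoeff_mul_fourierMonomial_nonneg hM hL · ξ) (fun α => ?_)
    ((summable_pow_mOrd (d := d) (r := 1 / 2) (by norm_num) (by norm_num)).mul_left C)
  have hMα := hM.1 (mOrd α)
  calc evenCoeff M L α * fourierMonomial α ξ
      ≤ (L ^ mOrd α * M (mOrd α))⁻¹ * (2 * π * ‖ξ‖) ^ mOrd α := by
        refine (mul_le_mul_of_nonneg_left ((le_abs_self _).trans (abs_fourierMonomial_le α ξ))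
          (evenCoeff_nonneg hM hL α)).trans ?_
        gcongr
        exact evenCoeff_le hM hL α
    _ = t ^ mOrd α / M (mOrd α) := by
        rw [ht, div_pow]
        field_simp
    _ ≤ ((1 / 2) * (2 * t + 1)) ^ mOrd α / M (mOrd α) := by
        gcongr
        linarith
    _ ≤ (1 / 2) ^ mOrd α * (C * M (mOrd α)) / M (mOrd α) := by
        rw [mul_pow]
        gcongr
        exact hCM _
    _ = C * (1 / 2) ^ mOrd α := by
        field_simp

lemma measurable_fourierWeight (hM3 : IsM3' M) : Measurable (fourierWeight (d := d) M L) := by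
  refine measurable_of_tendsto_metrizable' (Filter.atTop (α := Finset (Fin d → ℕ)))
    (f := fun s ξ => ∑ α ∈ s, evenCoeff M L α * fourierMonomial α ξ) (fun s => ?_)
    (tendsto_pi_nhds.mpr fun ξ => (summable_fourierWeight hM hL hM3 ξ).hasSum)
  exact (continuous_finsetSum _ fun α _ =>
    continuous_const.mul (continuous_fourierMonomial α)).measurable

lemma fourierWeight_nonneg (ξ : Rd d) : 0 ≤ fourierWeight M L ξ :=
  tsum_nonneg fun α => evenCoeff_mul_fourierMonomial_nonneg hM hL α ξ

lemma inv_le_fourierWeight (hM3 : IsM3' M) (ξ : Rd d) : (M 0)⁻¹ ≤ fourierWeight M L ξ := by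
  have := (summable_fourierWeight hM hL hM3 ξ).le_tsum 0
    fun α _ => evenCoeff_mul_fourierMonomial_nonneg hM hL α ξ
  rwa [show evenCoeff M L 0 * fourierMonomial 0 ξ = (M 0)⁻¹ by
    simp [evenCoeff, fourierMonomial, mOrd]] at this

lemma pow_le_fourierWeight (hM3 : IsM3' M) (ξ : Rd d) (i : Fin d) (q : ℕ) :
    (2 * π * ξ i) ^ (2 * q) ≤ L ^ (2 * q) * M (2 * q) * fourierWeight M L ξ := by
  have h := (summable_fourierWeight hM hL hM3 ξ).le_tsum (Pi.single i (2 * q))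
    fun α _ => evenCoeff_mul_fourierMonomial_nonneg hM hL α ξ
  have heven : ∀ j, Even ((Pi.single i (2 * q) : Fin d → ℕ) j) := fun j => by
    by_cases hj : j = i
    · subst hj; simp
    · simp [hj]
  rw [evenCoeff, if_pos heven, fourierMonomial_single, mOrd_single,
    inv_mul_le_iff₀ (mul_pos (pow_pos hL _) (hM.1 _))] at h
  exact h

end Weight

lemma exists_norm_sq_le (ξ : Rd d) (hξ : ξ ≠ 0) : ∃ i, ‖ξ‖ ^ 2 ≤ d * (ξ i) ^ 2 := by
  by_contra! hcon
  have hd : Nonempty (Fin d) := by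
    by_contra hne
    rw [not_nonempty_iff] at hne
    exact hξ (Subsingleton.elim _ _)
  have h1 : ∑ i, (d : ℝ) * (ξ i) ^ 2 < ∑ _i : Fin d, ‖ξ‖ ^ 2 :=
    Finset.sum_lt_sum_of_nonempty Finset.univ_nonempty fun i _ => hcon i
  rw [← Finset.mul_sum, EuclideanSpace.norm_sq_eq] at h1
  simp at h1

/-- Every monomial, even multiplied by a fixed power of `1 + ‖ξ‖`, is controlled by the Fourier
weight. -/
lemma exists_fourierWeight_bound {M : ℕ → ℝ} (hM : IsM1 M) (hM2 : IsM2' M) (hM3 : IsM3' M)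
    {ℓ : ℝ} (hℓ : 0 < ℓ) (N : ℕ) :
    ∃ L > (0 : ℝ), ∃ C > (0 : ℝ), ∀ (α : Fin d → ℕ) (ξ : Rd d),
      |fourierMonomial α ξ| * (1 + ‖ξ‖) ^ (2 * N)
        ≤ C * (ℓ ^ mOrd α * M (mOrd α)) * fourierWeight M L ξ := by
  obtain ⟨A, H, hA, hH, hshift⟩ := IsM2'.shift hM hM2 (2 * N + 1)
  obtain ⟨C₁, hC₁, hgeo⟩ := exists_geometric_le hM hM3 (L := ℓ⁻¹) (inv_pos.mpr hℓ)
  set L := min 1 ℓ / ((d + 1) * H) with hLdef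
  have hmin : 0 < min 1 ℓ := lt_min one_pos hℓ
  have hL : 0 < L := by positivity
  have hdLH : d * L * H ≤ min 1 ℓ := by
    calc d * L * H ≤ (d + 1) * L * H := by gcongr; linarith
      _ = min 1 ℓ := by rw [hLdef]; field_simp
  have hdL1 : d * L ≤ 1 := by
    calc d * L ≤ d * L * H := le_mul_of_one_le_right (by positivity) hH
      _ ≤ 1 := hdLH.trans (min_le_left _ _)
  have hM0 := hM.1 0
  refine ⟨L, hL, 2 ^ (2 * N) * (C₁ * M 0 + A), by positivity, fun α ξ => ?_⟩
  set p := mOrd α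
  have hMp := hM.1 p
  set t := 2 * π * ‖ξ‖ with ht
  have hw0 := fourierWeight_nonneg (d := d) hM hL ξ
  have hξt : ‖ξ‖ ≤ t := by
    have : 1 ≤ 2 * π := by linarith [Real.pi_gt_three]
    exact le_mul_of_one_le_left (norm_nonneg _) this
  have ht0 : 0 ≤ t := (norm_nonneg _).trans hξt
  have hαt := abs_fourierMonomial_le α ξ
  rcases le_total t 1 with ht1 | ht1
  · have h1 : 1 ≤ C₁ * M 0 * (ℓ ^ p * M p) * fourierWeight M L ξ := by
      have h2 := hgeo p
      rw [inv_pow, inv_le_iff_one_le_mul₀ (by positivity)] at h2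
      have h3 := inv_le_fourierWeight hM hL hM3 ξ
      rw [inv_le_iff_one_le_mul₀ hM0] at h3
      calc (1 : ℝ) = 1 * 1 := by ring
        _ ≤ (C₁ * M p * ℓ ^ p) * (fourierWeight M L ξ * M 0) := by gcongr
        _ = _ := by ring
    calc |fourierMonomial α ξ| * (1 + ‖ξ‖) ^ (2 * N) ≤ 1 * 2 ^ (2 * N) := by
          gcongr
          · exact hαt.trans (pow_le_one₀ ht0 ht1)
          · linarith
      _ ≤ (C₁ * M 0 * (ℓ ^ p * M p) * fourierWeight M L ξ) * 2 ^ (2 * N) := by gcongr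
      _ = 2 ^ (2 * N) * (C₁ * M 0) * (ℓ ^ p * M p) * fourierWeight M L ξ := by ring
      _ ≤ _ := by
          gcongr
          linarith
  · have hξ : ξ ≠ 0 := by
      rintro rfl
      rw [ht, norm_zero, mul_zero] at ht1
      linarith
    obtain ⟨i, hi⟩ := exists_norm_sq_le ξ hξ
    obtain ⟨q, k, hk, hqk⟩ : ∃ q k, k ≤ 2 * N + 1 ∧ 2 * q = p + k ∧ 2 * N ≤ k := by
      rcases Nat.even_or_odd' p with ⟨c, hc | hc⟩
      · exact ⟨c + N, 2 * N, by omega, by omega, by omega⟩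
      · exact ⟨c + N + 1, 2 * N + 1, by omega, by omega, by omega⟩
    have hd1 : (1 : ℝ) ≤ d := by
      have : 0 < d := i.pos
      exact_mod_cast this
    have h2q : t ^ (2 * q) ≤ (d : ℝ) ^ (2 * q) * (2 * π * ξ i) ^ (2 * q) := by
      have h3 : t ^ 2 ≤ (d * (2 * π * ξ i)) ^ 2 := by
        calc t ^ 2 = (2 * π) ^ 2 * ‖ξ‖ ^ 2 := by rw [ht]; ring
          _ ≤ (2 * π) ^ 2 * (d * (ξ i) ^ 2) := by gcongr
          _ ≤ (2 * π) ^ 2 * (d ^ 2 * (ξ i) ^ 2) := by gcongr; nlinarith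
          _ = _ := by ring
      rw [← mul_pow, pow_mul, pow_mul]
      exact pow_le_pow_left₀ (sq_nonneg _) h3 q
    calc |fourierMonomial α ξ| * (1 + ‖ξ‖) ^ (2 * N) ≤ t ^ p * (2 * t) ^ (2 * N) := by
          gcongr
          linarith
      _ = 2 ^ (2 * N) * t ^ (p + 2 * N) := by rw [mul_pow (2 : ℝ) t, pow_add]; ring
      _ ≤ 2 ^ (2 * N) * t ^ (2 * q) := by
          gcongr
          omega
      _ ≤ 2 ^ (2 * N) * ((d : ℝ) ^ (2 * q) * (L ^ (2 * q) * M (2 * q) * fourierWeight M L ξ)) := by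
          gcongr
          exact h2q.trans (by gcongr; exact pow_le_fourierWeight hM hL hM3 ξ i q)
      _ = 2 ^ (2 * N) * ((d * L) ^ p * (d * L) ^ k * M (p + k)) * fourierWeight M L ξ := by
          rw [hqk.1, ← pow_add, mul_pow (d : ℝ)]; ring
      _ ≤ 2 ^ (2 * N) * ((d * L) ^ p * 1 * (A * H ^ p * M p)) * fourierWeight M L ξ := by
          gcongr
          · exact (hM.1 _).le
          · exact pow_le_one₀ (by positivity) hdL1
          · exact hshift p k hk
      _ = 2 ^ (2 * N) * A * ((d * L * H) ^ p * M p) * fourierWeight M L ξ := by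
          rw [mul_pow (_ * _)]; ring
      _ ≤ 2 ^ (2 * N) * (C₁ * M 0 + A) * (ℓ ^ p * M p) * fourierWeight M L ξ := by
          gcongr
          · have : 0 < C₁ * M 0 := by positivity
            linarith
          · exact hdLH.trans (min_le_right _ _)

/-! ### Representation through the Fourier transform -/

open FourierTransform

/-- A functional dominated by a Hilbert seminorm is an inner product. -/
lemma exists_inner_repr {E H : Type*} [AddCommGroup E] [Module ℂ E] [NormedAddCommGroup H]
    [InnerProductSpace ℂ H] [CompleteSpace H] (J : E →ₗ[ℂ] H) (T : E →ₗ[ℂ] ℂ) {C : ℝ} (hC : 0 ≤ C)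
    (h : ∀ e, ‖T e‖ ≤ C * ‖J e‖) : ∃ g : H, ‖g‖ ≤ C ∧ ∀ e, T e = inner ℂ g (J e) := by
  obtain ⟨s, hs⟩ := J.rangeRestrict.exists_rightInverse_of_surjective J.range_rangeRestrict
  have hs' : ∀ y, J (s y) = y := fun y => congrArg Subtype.val (LinearMap.congr_fun hs y)
  let S : LinearMap.range J →L[ℂ] ℂ := (T ∘ₗ s).mkContinuous C fun y => by
    have := h (s y)
    rwa [hs'] at this
  obtain ⟨g, hg, hgS⟩ := exists_extension_norm_eq _ S
  refine ⟨(InnerProductSpace.toDual ℂ H).symm g, ?_, fun e => ?_⟩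
  · rw [LinearIsometryEquiv.norm_map, hgS]
    exact LinearMap.mkContinuous_norm_le _ hC _
  · rw [InnerProductSpace.toDual_symm_apply]
    have h1 : g (J e) = T (s (J.rangeRestrict e)) := hg (J.rangeRestrict e)
    have h2 := h (e - s (J.rangeRestrict e))
    have h3 : ((J.rangeRestrict e : LinearMap.range J) : H) = J e := rfl
    rw [map_sub, map_sub, hs', h3, sub_self, norm_zero, mul_zero] at h2
    rw [h1]
    exact sub_eq_zero.mp (norm_le_zero_iff.mp h2)

lemma integral_norm_mul_le_toLp {α : Type*} [MeasurableSpace α] {μ : Measure α} {f g : α → ℂ}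
    (hf : MemLp f 2 μ) (hg : MemLp g 2 μ) :
    ∫ x, ‖f x‖ * ‖g x‖ ∂μ ≤ ‖hf.toLp f‖ * ‖hg.toLp g‖ := by
  have hn : ∀ {f : α → ℂ} (hf : MemLp f 2 μ), ‖hf.toLp f‖ = (∫ x, ‖f x‖ ^ (2 : ℝ) ∂μ) ^ (1 / 2 : ℝ) := by
    intro f hf
    rw [Lp.norm_toLp, hf.eLpNorm_eq_integral_rpow_norm (by norm_num) (by norm_num),
      ENNReal.toReal_ofReal (by positivity)]
    norm_num
  rw [hn hf, hn hg]
  have h2 : (ENNReal.ofReal 2) = 2 := by norm_num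
  exact integral_mul_norm_le_Lp_mul_Lq (by constructor <;> norm_num) (h2 ▸ hf) (h2 ▸ hg)

section Smooth

variable {φ : Rd d → ℂ} (hs : ContDiff ℝ (⊤ : ℕ∞) φ) (hc : HasCompactSupport φ)
include hs hc

lemma integrable_mderiv (α : Fin d → ℕ) : Integrable (mderiv α φ) :=
  (contDiff_mderiv hs α).continuous.integrable_of_hasCompactSupport
    (hc.of_isClosed_subset (isClosed_tsupport _) (tsupport_mderiv_subset hs α))

lemma fourier_pder (i : Fin d) (ξ : Rd d) :
    𝓕 (pder i φ) ξ = Complex.I * ((2 * π * ξ i : ℝ) : ℂ) * 𝓕 φ ξ := by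
  have hφ : Integrable φ := hs.continuous.integrable_of_hasCompactSupport hc
  have hφ' : Integrable (fderiv ℝ φ) :=
    (hs.continuous_fderiv (by simp)).integrable_of_hasCompactSupport (hc.fderiv ℝ)
  have h := congrFun (Real.fourier_fderiv hφ (hs.differentiable (by simp)) hφ') ξ
  have h' := congrArg (fun T : Rd d →L[ℝ] ℂ => T (EuclideanSpace.single i 1)) h
  simp only [Real.fourier_continuousLinearMap_apply hφ'] at h'
  change 𝓕 (pder i φ) ξ = _ at h'
  rw [h']
  have hi : innerSL ℝ ξ (EuclideanSpace.single i 1) = ξ i := by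
    rw [innerSL_apply_apply, EuclideanSpace.inner_single_right]
    simp
  simp [VectorFourier.fourierSMulRight_apply, hi]
  ring

lemma fourier_mderiv (α : Fin d → ℕ) (ξ : Rd d) :
    𝓕 (mderiv α φ) ξ = Complex.I ^ mOrd α * (fourierMonomial α ξ : ℂ) * 𝓕 φ ξ := by
  induction α using multiIndex_induction with
  | h0 => simp [mderiv_zero, mOrd, fourierMonomial]
  | hs α i ih =>
    have hm : fourierMonomial (α + Pi.single i 1) ξ = (2 * π * ξ i) * fourierMonomial α ξ := by
      have : 2 * π * ξ i = fourierMonomial (Pi.single i 1) ξ := by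
        rw [fourierMonomial_single, pow_one]
      rw [this, fourierMonomial, fourierMonomial, fourierMonomial, ← Finset.prod_mul_distrib]
      refine Finset.prod_congr rfl fun j _ => ?_
      rw [Pi.add_apply, pow_add, mul_comm]
    rw [mderiv_add_single hs, fourier_pder (contDiff_mderiv hs α)
      (hc.of_isClosed_subset (isClosed_tsupport _) (tsupport_mderiv_subset hs α)), ih, hm,
      mOrd_add, mOrd_single]
    push_cast
    ring

lemma norm_fourier_mderiv (α : Fin d → ℕ) (ξ : Rd d) :
    ‖𝓕 (mderiv α φ) ξ‖ = |fourierMonomial α ξ| * ‖𝓕 φ ξ‖ := by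
  rw [fourier_mderiv hs hc, norm_mul, norm_mul, norm_pow, Complex.norm_I, one_pow, one_mul,
    Complex.norm_real, Real.norm_eq_abs]

end Smooth

lemma continuous_fourier {m : Rd d → ℂ} (hm : Integrable m) : Continuous (𝓕 m) :=
  VectorFourier.fourierIntegral_continuous Real.continuous_fourierChar
    (innerSL ℝ).continuous₂ hm

lemma norm_fourier_le (m : Rd d → ℂ) (ξ : Rd d) : ‖𝓕 m ξ‖ ≤ ∫ x, ‖m x‖ :=
  VectorFourier.norm_fourierIntegral_le_integral_norm _ _ _ _ _

lemma integral_mul_fourier {m ψ : Rd d → ℂ} (hm : Integrable m) (hψ : Integrable ψ) :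
    ∫ ξ, m ξ * 𝓕 ψ ξ = ∫ x, 𝓕 m x * ψ x := by
  have := VectorFourier.integral_fourierIntegral_smul_eq_flip (L := innerₗ (Rd d))
    Real.continuous_fourierChar (innerSL ℝ).continuous₂ hm hψ
  rw [flip_innerₗ] at this
  exact this.symm

/-- The square-integrable function `(1 + ‖ξ‖)^{-(d+1)}`. -/
def decayFn (ξ : Rd d) : ℂ := ((((1 + ‖ξ‖) ^ (d + 1))⁻¹ : ℝ) : ℂ)

lemma norm_decayFn (ξ : Rd d) : ‖decayFn ξ‖ = ((1 + ‖ξ‖) ^ (d + 1))⁻¹ := by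
  rw [decayFn, Complex.norm_real, Real.norm_of_nonneg (by positivity)]

lemma continuous_decayFn : Continuous (decayFn (d := d)) := by
  refine Complex.continuous_ofReal.comp (Continuous.inv₀ (by fun_prop) fun ξ => ?_)
  positivity

lemma memLp_decayFn : MemLp (decayFn (d := d)) 2 := by
  rw [memLp_two_iff_integrable_sq_norm continuous_decayFn.aestronglyMeasurable]
  have h := integrable_one_add_norm (E := Rd d) (μ := volume) (r := ((2 * (d + 1) : ℕ) : ℝ)) (by
    rw [finrank_euclideanSpace_fin]
    push_cast
    linarith [d.cast_nonneg (α := ℝ)])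
  refine h.congr (Filter.Eventually.of_forall fun ξ => ?_)
  simp only
  rw [norm_decayFn, Real.rpow_neg (by positivity), Real.rpow_natCast, inv_pow, ← pow_mul, mul_comm 2]

section Parametrix

variable {M : ℕ → ℝ} (hM : IsM1 M) {L : ℝ} (hL : 0 < L)
include hM hL

lemma exists_evenCoeff_fourier_bound {φ : Rd d → ℂ} (hφ : IsTestD M φ) :
    ∃ B, 0 ≤ B ∧ ∀ α ξ, evenCoeff M L α * ‖𝓕 (mderiv α φ) ξ‖ ≤ B * (1 / 2) ^ mOrd α := by
  obtain ⟨hs, hc, hb⟩ := (isTestD_iff hM).mp hφ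
  obtain ⟨B, hB, hφB⟩ := hb (L / 2) (by positivity)
  refine ⟨B * (volume (tsupport φ)).toReal, by positivity, fun α ξ => ?_⟩
  have hMα := hM.1 (mOrd α)
  have h1 : ∫ x, ‖mderiv α φ x‖ ≤ B * ((L / 2) ^ mOrd α * M (mOrd α)) * (volume (tsupport φ)).toReal := by
    rw [← setIntegral_eq_integral_of_forall_compl_eq_zero (s := tsupport φ)
      fun x hx => by rw [mderiv_eq_zero hs α hx, norm_zero]]
    have := norm_setIntegral_le_of_norm_le_const (μ := volume) (s := tsupport φ)
      (f := fun x => ‖mderiv α φ x‖) (C := B * ((L / 2) ^ mOrd α * M (mOrd α)))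
      hc.isCompact.measure_lt_top (fun x _ => by rw [norm_norm]; exact hφB α x)
    exact (le_abs_self _).trans this
  calc evenCoeff M L α * ‖𝓕 (mderiv α φ) ξ‖
      ≤ (L ^ mOrd α * M (mOrd α))⁻¹
        * (B * ((L / 2) ^ mOrd α * M (mOrd α)) * (volume (tsupport φ)).toReal) := by
        gcongr
        · exact evenCoeff_le hM hL α
        · exact (norm_fourier_le _ _).trans h1
    _ = _ := by
        rw [div_pow, div_pow, one_pow]
        field_simp

lemma evenCoeff_mul_norm_fourier {φ : Rd d → ℂ} (hφ : IsTestD M φ) (α : Fin d → ℕ) (ξ : Rd d) :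
    evenCoeff M L α * ‖𝓕 (mderiv α φ) ξ‖ = evenCoeff M L α * fourierMonomial α ξ * ‖𝓕 φ ξ‖ := by
  have h := evenCoeff_mul_fourierMonomial_nonneg hM hL α ξ
  rw [norm_fourier_mderiv hφ.1 hφ.2.1, ← mul_assoc]
  congr 1
  rw [← abs_of_nonneg (evenCoeff_nonneg hM hL α), ← abs_mul, abs_of_nonneg h,
    abs_of_nonneg (evenCoeff_nonneg hM hL α)]

lemma exists_fourierWeight_mul_bound {φ : Rd d → ℂ} (hφ : IsTestD M φ) :
    ∃ B, 0 ≤ B ∧ ∀ ξ, fourierWeight M L ξ * ‖𝓕 φ ξ‖ ≤ B := by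
  obtain ⟨B, hB, hb⟩ := exists_evenCoeff_fourier_bound hM hL hφ
  have hsum := summable_pow_mOrd (d := d) (r := 1 / 2) (by norm_num) (by norm_num)
  refine ⟨B * ∑' α : Fin d → ℕ, (1 / 2 : ℝ) ^ mOrd α,
    mul_nonneg hB (tsum_nonneg fun α => by positivity), fun ξ => ?_⟩
  rw [fourierWeight, ← tsum_mul_right, ← tsum_mul_left]
  have hle : ∀ α, evenCoeff M L α * fourierMonomial α ξ * ‖𝓕 φ ξ‖ ≤ B * (1 / 2) ^ mOrd α :=
    fun α => by rw [← evenCoeff_mul_norm_fourier hM hL hφ]; exact hb α ξ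
  exact (Summable.of_nonneg_of_le (fun α => mul_nonneg
    (evenCoeff_mul_fourierMonomial_nonneg hM hL α ξ) (norm_nonneg _)) hle
    (hsum.mul_left B)).tsum_le_tsum hle (hsum.mul_left B)

end Parametrix

/-- The weighted Fourier transform of a function. -/
def weightedFourier (M : ℕ → ℝ) (L : ℝ) (φ : Rd d → ℂ) (ξ : Rd d) : ℂ :=
  decayFn ξ * ((fourierWeight M L ξ : ℂ) * 𝓕 φ ξ)

section Parametrix

variable {M : ℕ → ℝ} (hM : IsM1 M) {L : ℝ} (hL : 0 < L)
include hM hL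

lemma norm_decayFn_mul_weightedFourier (φ : Rd d → ℂ) (ξ : Rd d) :
    ‖decayFn ξ‖ * ‖weightedFourier M L φ ξ‖
      = ((1 + ‖ξ‖) ^ (2 * (d + 1)))⁻¹ * (fourierWeight M L ξ * ‖𝓕 φ ξ‖) := by
  rw [weightedFourier, norm_mul, norm_mul, Complex.norm_real,
    Real.norm_of_nonneg (fourierWeight_nonneg hM hL ξ), norm_decayFn, mul_comm 2, pow_mul, sq,
    mul_inv, mul_assoc]

variable (hM3 : IsM3' M)
include hM3

lemma memLp_weightedFourier {φ : Rd d → ℂ} (hφ : IsTestD M φ) :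
    MemLp (weightedFourier M L φ) 2 := by
  obtain ⟨B, -, hB⟩ := exists_fourierWeight_mul_bound hM hL hφ
  have hφi : Integrable φ := hφ.1.continuous.integrable_of_hasCompactSupport hφ.2.1
  refine memLp_decayFn.of_le_mul (c := B) (Measurable.aestronglyMeasurable ?_)
    (Filter.Eventually.of_forall fun ξ => ?_)
  · exact continuous_decayFn.measurable.mul
      ((Complex.measurable_ofReal.comp (measurable_fourierWeight hM hL hM3)).mul
        (continuous_fourier hφi).measurable)
  · rw [weightedFourier, norm_mul, norm_mul, Complex.norm_real,
      Real.norm_of_nonneg (fourierWeight_nonneg hM hL ξ), mul_comm]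
    gcongr
    exact hB ξ

lemma eBound_of_weightedFourier {ℓ C : ℝ} (hC : 0 ≤ C) (hℓ : 0 < ℓ)
    (hLC : ∀ (α : Fin d → ℕ) (ξ : Rd d), |fourierMonomial α ξ| * (1 + ‖ξ‖) ^ (2 * (d + 1))
      ≤ C * (ℓ ^ mOrd α * M (mOrd α)) * fourierWeight M L ξ)
    {φ : Rd d → ℂ} (hφ : IsTestD M φ) :
    EBound M ℓ (C * ‖(memLp_decayFn (d := d)).toLp decayFn‖
      * ‖(memLp_weightedFourier hM hL hM3 hφ).toLp (weightedFourier M L φ)‖) φ := by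
  intro α x
  set X := ℓ ^ mOrd α * M (mOrd α) with hX
  have hX0 : 0 ≤ X := mul_nonneg (pow_nonneg hℓ.le _) (hM.1 _).le
  have hw := memLp_weightedFourier hM hL hM3 hφ
  have hle : ∀ ξ, ‖𝓕 (mderiv α φ) ξ‖ ≤ C * X * (‖decayFn ξ‖ * ‖weightedFourier M L φ ξ‖) := by
    intro ξ
    rw [norm_fourier_mderiv hφ.1 hφ.2.1, norm_decayFn_mul_weightedFourier hM hL]
    have hpos : (0 : ℝ) < (1 + ‖ξ‖) ^ (2 * (d + 1)) := by positivity
    calc |fourierMonomial α ξ| * ‖𝓕 φ ξ‖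
        = (|fourierMonomial α ξ| * (1 + ‖ξ‖) ^ (2 * (d + 1)))
          * (((1 + ‖ξ‖) ^ (2 * (d + 1)))⁻¹ * ‖𝓕 φ ξ‖) := by field_simp
      _ ≤ (C * X * fourierWeight M L ξ) * (((1 + ‖ξ‖) ^ (2 * (d + 1)))⁻¹ * ‖𝓕 φ ξ‖) := by
        exact mul_le_mul_of_nonneg_right (hLC α ξ) (by positivity)
      _ = _ := by ring
  have hint : Integrable fun ξ => C * X * (‖decayFn ξ‖ * ‖weightedFourier M L φ ξ‖) :=
    ((memLp_decayFn (d := d)).norm.integrable_mul hw.norm).const_mul _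
  have hφi := integrable_mderiv hφ.1 hφ.2.1 α
  have hFi : Integrable (𝓕 (mderiv α φ)) :=
    hint.mono' (continuous_fourier hφi).aestronglyMeasurable (Filter.Eventually.of_forall hle)
  have hinv := congrFun
    ((contDiff_mderiv hφ.1 α).continuous.fourierInv_fourier_eq hφi hFi) x
  rw [← hinv, Real.fourierInv_eq]
  refine (norm_integral_le_integral_norm _).trans ?_
  simp only [Circle.norm_smul]
  calc ∫ ξ, ‖𝓕 (mderiv α φ) ξ‖
      ≤ ∫ ξ, C * X * (‖decayFn ξ‖ * ‖weightedFourier M L φ ξ‖) :=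
        integral_mono hFi.norm hint hle
    _ = C * X * ∫ ξ, ‖decayFn ξ‖ * ‖weightedFourier M L φ ξ‖ := integral_const_mul _ _
    _ ≤ C * X * (‖(memLp_decayFn (d := d)).toLp decayFn‖ * ‖hw.toLp (weightedFourier M L φ)‖) := by
        gcongr
        exact integral_norm_mul_le_toLp memLp_decayFn hw
    _ = _ := by ring

lemma hasSum_mul_weightedFourier {m : Rd d → ℂ} (hm : Integrable m) {φ : Rd d → ℂ}
    (hφ : IsTestD M φ) :
    HasSum (fun α : Fin d → ℕ => (evenCoeff M L α * (-Complex.I) ^ mOrd α) *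
        ∫ x, 𝓕 m x * mderiv α φ x)
      (∫ ξ, m ξ * ((fourierWeight M L ξ : ℂ) * 𝓕 φ ξ)) := by
  obtain ⟨B, hB, hb⟩ := exists_evenCoeff_fourier_bound hM hL hφ
  set F : (Fin d → ℕ) → Rd d → ℂ := fun α ξ =>
    (evenCoeff M L α * (-Complex.I) ^ mOrd α) * (m ξ * 𝓕 (mderiv α φ) ξ) with hF
  have hFle : ∀ α ξ, ‖F α ξ‖ ≤ B * (1 / 2) ^ mOrd α * ‖m ξ‖ := by
    intro α ξ
    simp only [hF, norm_mul, Complex.norm_real, norm_pow, norm_neg, Complex.norm_I, one_pow,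
      mul_one]
    rw [Real.norm_of_nonneg (evenCoeff_nonneg hM hL α), mul_comm ‖m ξ‖, ← mul_assoc]
    exact mul_le_mul_of_nonneg_right (hb α ξ) (norm_nonneg _)
  have hFi : ∀ α, Integrable (F α) := fun α =>
    (hm.norm.const_mul (B * (1 / 2) ^ mOrd α)).mono'
      ((hm.aestronglyMeasurable.mul (continuous_fourier
        (integrable_mderiv hφ.1 hφ.2.1 α)).aestronglyMeasurable).const_mul _)
      (Filter.Eventually.of_forall (hFle α))
  have hsum := summable_pow_mOrd (d := d) (r := 1 / 2) (by norm_num) (by norm_num)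
  have h := hasSum_integral_of_summable_integral_norm hFi
    (Summable.of_nonneg_of_le (fun α => integral_nonneg fun ξ => norm_nonneg _)
      (fun α => integral_mono (hFi α).norm (hm.norm.const_mul (B * (1 / 2) ^ mOrd α)) (hFle α))
      (by simp_rw [integral_const_mul]; exact (hsum.mul_left B).mul_right _))
  have hterm : ∀ α, ∫ ξ, F α ξ = (evenCoeff M L α * (-Complex.I) ^ mOrd α) *
      ∫ x, 𝓕 m x * mderiv α φ x := fun α => by
    rw [integral_const_mul, integral_mul_fourier hm (integrable_mderiv hφ.1 hφ.2.1 α)]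
  have htot : ∀ ξ, ∑' α, F α ξ = m ξ * ((fourierWeight M L ξ : ℂ) * 𝓕 φ ξ) := by
    intro ξ
    have h1 := ((Complex.hasSum_ofReal.mpr (summable_fourierWeight hM hL hM3 ξ).hasSum).mul_right
      (𝓕 φ ξ)).mul_left (m ξ)
    rw [fourierWeight, ← h1.tsum_eq]
    refine tsum_congr fun α => ?_
    have hI : (-Complex.I) ^ mOrd α * Complex.I ^ mOrd α = 1 := by
      rw [← mul_pow, neg_mul, Complex.I_mul_I, neg_neg, one_pow]
    simp only [hF]
    rw [fourier_mderiv hφ.1 hφ.2.1]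
    push_cast
    linear_combination (evenCoeff M L α * m ξ * fourierMonomial α ξ * 𝓕 φ ξ) * hI
  simp_rw [hterm, htot] at h
  exact h

end Parametrix

/-- The test functions of class `(M_p)` supported in `K`. -/
def testOn {M : ℕ → ℝ} (hM : IsM1 M) (K : Set (Rd d)) : Submodule ℂ (Rd d → ℂ) where
  carrier := {φ | IsTestD M φ ∧ tsupport φ ⊆ K}
  zero_mem' := ⟨(isTestD_iff hM).mpr ⟨contDiff_const, HasCompactSupport.zero, fun ℓ hℓ =>
    ⟨0, le_rfl, fun α x => by simp [mderiv_const_zero]⟩⟩, by simp [tsupport]⟩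
  add_mem' := fun hφ hψ => ⟨isTestD_add hM hφ.1 hψ.1,
    (tsupport_add _ _).trans (Set.union_subset hφ.2 hψ.2)⟩
  smul_mem' := fun c _ hφ => ⟨isTestD_smul hM hφ.1 c,
    (tsupport_smul_subset_right (fun _ => c) _).trans hφ.2⟩

/-- A functional that is continuous on the test functions supported in `K` is obtained by
integrating an infinite-order differential operator against a continuous bounded function; the
operator depends only on `K` and on the order of continuity. -/
lemma exists_parametrix {M : ℕ → ℝ} (hM : IsM1 M) (hM2 : IsM2' M) (hM3 : IsM3' M)
    (K : Set (Rd d)) {ℓ : ℝ} (hℓ : 0 < ℓ) :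
    ∃ a : (Fin d → ℕ) → ℂ, ∃ L > (0 : ℝ), ∃ A > (0 : ℝ),
      (∀ α, ‖a α‖ ≤ (L ^ mOrd α * M (mOrd α))⁻¹) ∧
      ∀ (T : (Rd d → ℂ) →ₗ[ℂ] ℂ) (c : ℝ), 0 ≤ c →
        (∀ φ B, IsTestD M φ → tsupport φ ⊆ K → 0 ≤ B → EBound M ℓ B φ → ‖T φ‖ ≤ c * B) →
        ∃ G : Rd d → ℂ, Continuous G ∧ (∀ x, ‖G x‖ ≤ A * c) ∧
          ∀ φ, IsTestD M φ → tsupport φ ⊆ K →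
            HasSum (fun α => a α * ∫ x, G x * mderiv α φ x) (T φ) := by
  obtain ⟨L, hL, C, hC, hLC⟩ := exists_fourierWeight_bound (d := d) hM hM2 hM3 hℓ (d + 1)
  set D := (memLp_decayFn (d := d)).toLp decayFn with hD
  refine ⟨fun α => evenCoeff M L α * (-Complex.I) ^ mOrd α, L, hL, C * ‖D‖ * ‖D‖ + 1,
    by positivity, fun α => ?_, fun T c hc hT => ?_⟩
  · rw [norm_mul, norm_pow, norm_neg, Complex.norm_I, one_pow, mul_one, Complex.norm_real,
      Real.norm_of_nonneg (evenCoeff_nonneg hM hL α)]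
    exact evenCoeff_le hM hL α
  have hint : ∀ {φ : Rd d → ℂ}, IsTestD M φ → Integrable φ := fun hφ =>
    hφ.1.continuous.integrable_of_hasCompactSupport hφ.2.1
  let J : testOn hM K →ₗ[ℂ] Lp ℂ 2 (volume : Measure (Rd d)) :=
    { toFun := fun φ => (memLp_weightedFourier hM hL hM3 φ.2.1).toLp (weightedFourier M L φ.1)
      map_add' := fun φ ψ => by
        rw [← MemLp.toLp_add]
        refine MemLp.toLp_congr _ _ (Filter.Eventually.of_forall fun ξ => ?_)
        have h : 𝓕 (φ.1 + ψ.1) ξ = 𝓕 φ.1 ξ + 𝓕 ψ.1 ξ :=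
          congrFun (VectorFourier.fourierIntegral_add
            Real.continuous_fourierChar (innerSL ℝ).continuous₂ (hint φ.2.1) (hint ψ.2.1)) ξ
        simp only [weightedFourier, Submodule.coe_add, Pi.add_apply, h]
        ring
      map_smul' := fun k φ => by
        rw [RingHom.id_apply, ← MemLp.toLp_const_smul]
        refine MemLp.toLp_congr _ _ (Filter.Eventually.of_forall fun ξ => ?_)
        have h : 𝓕 (k • φ.1) ξ = k • 𝓕 φ.1 ξ := 
          congrFun (VectorFourier.fourierIntegral_const_smul _ _ _ φ.1 k) ξ
        simp only [weightedFourier, Submodule.coe_smul, Pi.smul_apply, h, smul_eq_mul]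
        ring }
  obtain ⟨g, hg, hgT⟩ := exists_inner_repr J (T ∘ₗ (testOn hM K).subtype)
    (C := c * (C * ‖D‖)) (by positivity) fun φ => by
      rw [mul_assoc]
      exact hT φ.1 _ φ.2.1 φ.2.2 (by positivity) (eBound_of_weightedFourier hM hL hM3 hC.le hℓ hLC φ.2.1)
  set m : Rd d → ℂ := fun ξ => starRingEnd ℂ (g ξ) * decayFn ξ with hm
  have hgL : MemLp (fun ξ => starRingEnd ℂ (g ξ)) 2 (volume : Measure (Rd d)) := (Lp.memLp g).star
  have hmi : Integrable m := hgL.integrable_mul memLp_decayFn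
  refine ⟨𝓕 m, continuous_fourier hmi, fun x => ?_, fun φ hφ hφK => ?_⟩
  · calc ‖𝓕 m x‖ ≤ ∫ ξ, ‖m ξ‖ := norm_fourier_le m x
      _ = ∫ ξ, ‖g ξ‖ * ‖decayFn ξ‖ := by simp only [hm, norm_mul, RCLike.norm_conj]
      _ ≤ ‖(Lp.memLp g).toLp g‖ * ‖D‖ := integral_norm_mul_le_toLp _ memLp_decayFn
      _ ≤ c * (C * ‖D‖) * ‖D‖ := by rw [Lp.toLp_coeFn]; gcongr
      _ ≤ (C * ‖D‖ * ‖D‖ + 1) * c := by nlinarith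
  · convert hasSum_mul_weightedFourier hM hL hM3 hmi hφ using 1
    rw [show T φ = _ from hgT ⟨φ, hφ, hφK⟩, L2.inner_def]
    refine integral_congr_ae ?_
    filter_upwards [(memLp_weightedFourier hM hL hM3 hφ).coeFn_toLp] with ξ hξ
    have h : J ⟨φ, hφ, hφK⟩ ξ = weightedFourier M L φ ξ := hξ
    rw [h, RCLike.inner_apply, weightedFourier]
    ring

/-- A locally finite-order representation by continuous functions of growth `ω` near `W` gives
`W`-translates of growth `ω`. -/
lemma exists_translate_le_of_repr {M : ℕ → ℝ} (hM : IsM1 M) {W : Set (Rd d)} {ω : Rd d → ℝ}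
    (hω : OmegaCond ω) {f : (Rd d → ℂ) →ₗ[ℂ] ℂ} {φ : Rd d → ℂ} (hφ : IsTestD M φ) {r ℓ C : ℝ}
    (hr : 0 < r) (hℓ : 0 < ℓ) (hC : 0 < C) (hsupp : tsupport φ ⊆ Metric.closedBall 0 r)
    {F : (Fin d → ℕ) → Rd d → ℂ}
    (hF : ∀ (α : Fin d → ℕ), ∀ x ∈ W + Metric.ball 0 (r + 1),
      ‖F α x‖ ≤ C * (ℓ ^ mOrd α / M (mOrd α)) * ω x)
    (hrep : ∀ ψ : Rd d → ℂ, IsTestD M ψ → tsupport ψ ⊆ W + Metric.ball 0 (r + 1) →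
      f ψ = ∑' α : Fin d → ℕ,
        (-1 : ℂ) ^ mOrd α * ∫ x in W + Metric.ball 0 (r + 1), F α x * mderiv α ψ x) :
    ∃ A : ℝ, ∀ h ∈ W, ‖f (fun x => φ (x - h))‖ ≤ A * ω h := by
  obtain ⟨hω0, -, hωR⟩ := hω
  obtain ⟨D, hD, hDω⟩ := hωR r hr
  obtain ⟨hs, hc, hb⟩ := (isTestD_iff hM).mp hφ
  obtain ⟨B, hB, hφB⟩ := hb (1 / (2 * ℓ)) (by positivity)
  set V := (volume (Metric.closedBall (0 : Rd d) r)).toReal with hV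
  have hsum := summable_pow_mOrd (d := d) (r := 1 / 2) (by norm_num) (by norm_num)
  refine ⟨C * D * B * V * ∑' α : Fin d → ℕ, (1 / 2 : ℝ) ^ mOrd α, fun h hh => ?_⟩
  have hball : Metric.closedBall h r ⊆ W + Metric.ball 0 (r + 1) := fun x hx =>
    ⟨h, hh, x - h, by
      rw [mem_ball_zero_iff, ← dist_eq_norm]
      exact lt_of_le_of_lt (Metric.mem_closedBall.mp hx) (by linarith), by simp⟩
  have hzero : ∀ α, ∀ x ∉ Metric.closedBall h r, mderiv α (fun x => φ (x - h)) x = 0 := by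
    intro α x hx
    rw [mderiv_comp_sub hs]
    refine mderiv_eq_zero hs α fun hx' => hx ?_
    have := hsupp hx'
    rwa [mem_closedBall_zero_iff, ← dist_eq_norm] at this
  have hψ : tsupport (fun x => φ (x - h)) ⊆ Metric.closedBall h r := by
    refine closure_minimal (fun x hx => ?_) Metric.isClosed_closedBall
    by_contra hx'
    exact hx (by simpa [mderiv_zero] using hzero 0 x hx')
  rw [hrep _ (isTestD_comp_sub hM hφ h) (hψ.trans hball)]
  have hle : ∀ α : Fin d → ℕ, ‖(-1 : ℂ) ^ mOrd α * ∫ x in W + Metric.ball 0 (r + 1),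
      F α x * mderiv α (fun x => φ (x - h)) x‖ ≤ C * D * B * V * ω h * (1 / 2) ^ mOrd α := by
    intro α
    have hMα := hM.1 (mOrd α)
    rw [norm_mul, norm_pow, norm_neg, norm_one, one_pow, one_mul,
      setIntegral_eq_of_subset_of_forall_sdiff_eq_zero
        (Metric.isOpen_ball.add_left).measurableSet hball
        (fun x hx => by rw [hzero α x hx.2, mul_zero])]
    refine (norm_setIntegral_le_of_norm_le_const (C := C * D * B * ω h * (1 / 2) ^ mOrd α)
      (isCompact_closedBall h r).measure_lt_top fun x hx => ?_).trans (le_of_eq ?_)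
    · have hωx : ω x ≤ D * ω h := by
        have := hDω h (x - h) (by rw [← dist_eq_norm]; exact hx)
        rwa [add_sub_cancel] at this
      rw [norm_mul, mderiv_comp_sub hs]
      calc ‖F α x‖ * ‖mderiv α φ (x - h)‖
          ≤ C * (ℓ ^ mOrd α / M (mOrd α)) * (D * ω h)
            * (B * ((1 / (2 * ℓ)) ^ mOrd α * M (mOrd α))) := by
            have := hω0 h
            gcongr
            · exact (hF α x (hball hx)).trans (by gcongr)
            · exact hφB α _
        _ = _ := by
            rw [div_pow, div_pow, mul_pow, one_pow]
            field_simp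
    · rw [measureReal_def, Measure.addHaar_closedBall_center, ← hV]
      ring
  refine (tsum_of_norm_bounded (hsum.mul_left _).hasSum hle).trans (le_of_eq ?_)
  rw [tsum_mul_left]
  ring

/-- The coefficient of `∂^β ψ` in `∑_α a_α ∂^α (χ ψ)`. -/
def leibnizCoeff (a : (Fin d → ℕ) → ℂ) (χ : Rd d → ℂ) (β : Fin d → ℕ) (x : Rd d) : ℂ :=
  ∑' α, a α * (mChoose α β * mderiv (α - β) χ x)

section Leibniz

lemma leibnizCoeff_comp_sub (a : (Fin d → ℕ) → ℂ) {χ : Rd d → ℂ}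
    (hχs : ContDiff ℝ (⊤ : ℕ∞) χ) (β : Fin d → ℕ) (h x : Rd d) :
    leibnizCoeff a (fun y => χ (y - h)) β x = leibnizCoeff a χ β (x - h) := by
  simp only [leibnizCoeff, mderiv_comp_sub hχs]

lemma leibnizCoeff_eq_zero (a : (Fin d → ℕ) → ℂ) {χ : Rd d → ℂ}
    (hχs : ContDiff ℝ (⊤ : ℕ∞) χ) (β : Fin d → ℕ) {x : Rd d} (hx : x ∉ tsupport χ) :
    leibnizCoeff a χ β x = 0 := by
  simp [leibnizCoeff, mderiv_eq_zero hχs _ hx]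

variable {M : ℕ → ℝ} (hM : IsM1 M) {L : ℝ} (hL : 0 < L) {a : (Fin d → ℕ) → ℂ}
  (ha : ∀ α, ‖a α‖ ≤ (L ^ mOrd α * M (mOrd α))⁻¹) {χ : Rd d → ℂ}
  (hχs : ContDiff ℝ (⊤ : ℕ∞) χ) {B : ℝ} (hB : 0 ≤ B) (hχB : EBound M (L / 4) B χ)
include hM hL ha hB hχB

lemma norm_leibnizCoeff_term_le (α β : Fin d → ℕ) (x : Rd d) :
    ‖a α * (mChoose α β * mderiv (α - β) χ x)‖
      ≤ B * M 0 * ((4 / L) ^ mOrd β / M (mOrd β)) * (1 / 2) ^ mOrd α := by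
  have hMp := hM.1
  have hM0 := hMp 0
  have hMβ := hMp (mOrd β)
  have hMα := hMp (mOrd α)
  by_cases hβα : β ≤ α
  · obtain ⟨γ, rfl⟩ := le_iff_exists_add.mp hβα
    have hMγ := hMp (mOrd γ)
    rw [add_tsub_cancel_left, norm_mul, norm_mul, Complex.norm_natCast]
    have h1 : (mChoose (β + γ) β : ℝ) ≤ 2 ^ mOrd (β + γ) := mod_cast mChoose_le (β + γ) β
    have h2 : M (mOrd γ) * (M (mOrd (β + γ)))⁻¹ ≤ M 0 * (M (mOrd β))⁻¹ := by
      rw [← div_eq_mul_inv, ← div_eq_mul_inv, div_le_div_iff₀ hMα hMβ, mul_comm, mOrd_add]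
      exact hM.mul_le _ _
    calc ‖a (β + γ)‖ * ((mChoose (β + γ) β : ℝ) * ‖mderiv γ χ x‖)
        ≤ (L ^ mOrd (β + γ) * M (mOrd (β + γ)))⁻¹
          * (2 ^ mOrd (β + γ) * (B * ((L / 4) ^ mOrd γ * M (mOrd γ)))) := by
          gcongr
          · exact ha _
          · exact hχB γ x
      _ = B * (4 / L) ^ mOrd β * (1 / 2) ^ mOrd (β + γ)
          * (M (mOrd γ) * (M (mOrd (β + γ)))⁻¹) := by
          have h4 : (4 : ℝ) = 2 * 2 := by norm_num
          simp only [mOrd_add, pow_add, div_pow, h4, mul_pow, one_pow]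
          field_simp
      _ ≤ B * (4 / L) ^ mOrd β * (1 / 2) ^ mOrd (β + γ) * (M 0 * (M (mOrd β))⁻¹) := by gcongr
      _ = _ := by ring
  · rw [mChoose_eq_zero hβα]
    simp only [Nat.cast_zero, zero_mul, mul_zero, norm_zero]
    positivity

lemma norm_leibnizCoeff_le (β : Fin d → ℕ) (x : Rd d) :
    ‖leibnizCoeff a χ β x‖ ≤ B * M 0 * (∑' α : Fin d → ℕ, (1 / 2 : ℝ) ^ mOrd α)
      * ((4 / L) ^ mOrd β / M (mOrd β)) := by
  have hsum := summable_pow_mOrd (d := d) (r := 1 / 2) (by norm_num) (by norm_num)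
  refine (tsum_of_norm_bounded (hsum.mul_left _).hasSum
    fun α => norm_leibnizCoeff_term_le hM hL ha hB hχB α β x).trans (le_of_eq ?_)
  rw [tsum_mul_left]
  ring

include hχs

lemma continuous_leibnizCoeff (β : Fin d → ℕ) : Continuous (leibnizCoeff a χ β) := by
  have hsum := summable_pow_mOrd (d := d) (r := 1 / 2) (by norm_num) (by norm_num)
  exact continuous_tsum (fun α => continuous_const.mul
      (continuous_const.mul (contDiff_mderiv hχs _).continuous)) (hsum.mul_left _)
    fun α x => norm_leibnizCoeff_term_le hM hL ha hB hχB α β x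

lemma exists_integral_leibniz_le {G : Rd d → ℂ} (hG : Continuous G) {ψ : Rd d → ℂ}
    (hψ : IsTestD M ψ) :
    ∃ Q, 0 ≤ Q ∧ ∀ α β : Fin d → ℕ,
      Integrable (fun x => G x * (a α * (mChoose α β * mderiv (α - β) χ x)) * mderiv β ψ x) ∧
      ∫ x, ‖G x * (a α * (mChoose α β * mderiv (α - β) χ x)) * mderiv β ψ x‖
        ≤ Q * (1 / 2) ^ mOrd α * (1 / 2) ^ mOrd β := by
  obtain ⟨hs, hc, hb⟩ := (isTestD_iff hM).mp hψ
  obtain ⟨B', hB', hψB⟩ := hb (L / 8) (by positivity)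
  have hM0 := hM.1 0
  set V := ∫ x in tsupport ψ, ‖G x‖ with hV
  have hV0 : 0 ≤ V := integral_nonneg fun _ => norm_nonneg _
  have hpt : ∀ α β x, ‖G x * (a α * (mChoose α β * mderiv (α - β) χ x)) * mderiv β ψ x‖
      ≤ B * M 0 * B' * (1 / 2) ^ mOrd α * (1 / 2) ^ mOrd β * ‖G x‖ := by
    intro α β x
    have hMβ := hM.1 (mOrd β)
    rw [norm_mul, norm_mul]
    calc ‖G x‖ * ‖a α * (mChoose α β * mderiv (α - β) χ x)‖ * ‖mderiv β ψ x‖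
        ≤ ‖G x‖ * (B * M 0 * ((4 / L) ^ mOrd β / M (mOrd β)) * (1 / 2) ^ mOrd α)
          * (B' * ((L / 8) ^ mOrd β * M (mOrd β))) := by
          gcongr
          · exact norm_leibnizCoeff_term_le hM hL ha hB hχB α β x
          · exact hψB β x
      _ = B * M 0 * B' * (1 / 2) ^ mOrd α * (4 / L * (L / 8)) ^ mOrd β * ‖G x‖ := by
          rw [mul_pow]
          field_simp
      _ = _ := by
          rw [show 4 / L * (L / 8) = 1 / 2 by field_simp; norm_num]
  have hi : ∀ α β, Integrable
      (fun x => G x * (a α * (mChoose α β * mderiv (α - β) χ x)) * mderiv β ψ x) := fun α β => by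
    refine Continuous.integrable_of_hasCompactSupport ((hG.mul (continuous_const.mul
      (continuous_const.mul (contDiff_mderiv hχs _).continuous))).mul
        (contDiff_mderiv hs β).continuous) (HasCompactSupport.mul_left ?_)
    exact hc.of_isClosed_subset (isClosed_tsupport _) (tsupport_mderiv_subset hs β)
  refine ⟨B * M 0 * B' * V, by positivity, fun α β => ⟨hi α β, ?_⟩⟩
  rw [← setIntegral_eq_integral_of_forall_compl_eq_zero (s := tsupport ψ)
    fun x hx => by rw [mderiv_eq_zero hs β hx, mul_zero, norm_zero]]
  refine (integral_mono (hi α β).norm.integrableOn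
    ((hG.norm.continuousOn.integrableOn_compact hc).const_mul _) (hpt α β)).trans (le_of_eq ?_)
  rw [integral_const_mul]
  ring

lemma hasSum_leibnizCoeff {G : Rd d → ℂ} (hG : Continuous G) {ψ : Rd d → ℂ} (hψ : IsTestD M ψ)
    {S : ℂ} (hS : HasSum (fun α => a α * ∫ x, G x * mderiv α (ψ * χ) x) S) :
    Summable (fun β => ‖∫ x, G x * leibnizCoeff a χ β x * mderiv β ψ x‖) ∧
      HasSum (fun β => ∫ x, G x * leibnizCoeff a χ β x * mderiv β ψ x) S := by
  obtain ⟨Q, hQ0, hQ⟩ := exists_integral_leibniz_le hM hL ha hχs hB hχB hG hψ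
  have hs := hψ.1
  set w : (Fin d → ℕ) → (Fin d → ℕ) → Rd d → ℂ := fun α β x =>
    G x * (a α * (mChoose α β * mderiv (α - β) χ x)) * mderiv β ψ x with hw
  have hsum := summable_pow_mOrd (d := d) (r := 1 / 2) (by norm_num) (by norm_num)
  have hwi : ∀ α β, Integrable (w α β) := fun α β => (hQ α β).1
  have hwle : ∀ α β, ∫ x, ‖w α β x‖ ≤ Q * (1 / 2) ^ mOrd α * (1 / 2) ^ mOrd β :=
    fun α β => (hQ α β).2
  set u : (Fin d → ℕ) → (Fin d → ℕ) → ℂ := fun α β => ∫ x, w α β x with hu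
  have hule : ∀ α β, ‖u α β‖ ≤ Q * (1 / 2) ^ mOrd α * (1 / 2) ^ mOrd β := fun α β =>
    (norm_integral_le_integral_norm _).trans (hwle α β)
  have husum : Summable (Function.uncurry u) := by
    refine Summable.of_norm_bounded (g := fun p : (Fin d → ℕ) × (Fin d → ℕ) =>
      Q * ((1 / 2) ^ mOrd p.1 * (1 / 2) ^ mOrd p.2)) ?_ fun p => ?_
    · exact (hsum.mul_of_nonneg hsum (fun _ => by positivity) fun _ => by positivity).mul_left Q
    · rw [← mul_assoc]
      exact hule p.1 p.2
  have hrow : ∀ α, ∑' β, u α β = a α * ∫ x, G x * mderiv α (ψ * χ) x := by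
    intro α
    rw [tsum_eq_sum (s := Finset.Iic α) fun β hβ => by
      rw [Finset.mem_Iic] at hβ
      simp [hu, hw, mChoose_eq_zero hβ], ← integral_const_mul,
      ← integral_finsetSum _ fun β _ => hwi α β]
    refine integral_congr_ae (Filter.Eventually.of_forall fun x => ?_)
    simp only [hw, mderiv_mul hs hχs, Finset.mul_sum]
    exact Finset.sum_congr rfl fun β _ => by ring
  have hcol : ∀ β, ∑' α, u α β = ∫ x, G x * leibnizCoeff a χ β x * mderiv β ψ x := by
    intro β
    have h := hasSum_integral_of_summable_integral_norm (fun α => hwi α β)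
      (Summable.of_nonneg_of_le (fun α => integral_nonneg fun x => norm_nonneg _)
        (fun α => hwle α β) ((hsum.mul_left Q).mul_right _))
    rw [h.tsum_eq]
    refine integral_congr_ae (Filter.Eventually.of_forall fun x => ?_)
    simp only [hw, tsum_mul_right, tsum_mul_left, leibnizCoeff]
  have hcolsum : Summable fun β => ‖∑' α, u α β‖ :=
    Summable.of_nonneg_of_le (fun β => norm_nonneg _)
      (fun β => (tsum_of_norm_bounded ((hsum.mul_left Q).mul_right _).hasSum (hule · β)).trans
        (le_of_eq tsum_mul_right)) (hsum.mul_left _)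
  simp_rw [← hcol]
  refine ⟨hcolsum, ?_⟩
  have h := hcolsum.of_norm.hasSum
  rwa [husum.tsum_comm, tsum_congr hrow, hS.tsum_eq] at h

end Leibniz

section Cells

variable {M : ℕ → ℝ} (hM : IsM1 M) (hM2 : IsM2' M) (hM3 : IsM3' M) {W : Set (Rd d)}
  {ω : Rd d → ℝ} {f : (Rd d → ℂ) →ₗ[ℂ] ℂ} (hf : IsUltraD M f)
  (hbd : ∀ φ : Rd d → ℂ, IsTestD M φ → ∃ C : ℝ, ∀ h ∈ W, ‖f (fun x => φ (x - h))‖ ≤ C * ω h)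
include hM hM2 hM3 hf hbd

/-- Near each point of `W` the functional is an infinite-order operator, the same for all points,
integrated against a continuous function. -/
lemma exists_repr_near (hω : ∀ x, 0 < ω x) (r : ℝ) :
    ∃ a : (Fin d → ℕ) → ℂ, ∃ L > (0 : ℝ), ∃ A > (0 : ℝ),
      (∀ α, ‖a α‖ ≤ (L ^ mOrd α * M (mOrd α))⁻¹) ∧
      ∀ h ∈ W, ∃ G : Rd d → ℂ, Continuous G ∧ (∀ x, ‖G x‖ ≤ A * ω h) ∧
        ∀ ψ, IsTestD M ψ → tsupport ψ ⊆ Metric.closedBall h r →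
          HasSum (fun α => a α * ∫ x, G x * mderiv α ψ x) (f ψ) := by
  obtain ⟨ℓ, hℓ, C, hC, hfC⟩ := exists_translate_bound hM hf hω hbd
    (isCompact_closedBall (0 : Rd d) r)
  obtain ⟨a, L, hL, A, hA, ha, hrep⟩ := exists_parametrix hM hM2 hM3
    (Metric.closedBall (0 : Rd d) r) hℓ
  refine ⟨a, L, hL, A * C, by positivity, ha, fun h hh => ?_⟩
  have hωh := hω h
  obtain ⟨G, hG, hGb, hGr⟩ := hrep (f ∘ₗ LinearMap.funLeft ℂ ℂ fun x => x - h) (C * ω h)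
    (by positivity) (hfC h hh)
  refine ⟨fun x => G (x - h), by fun_prop, fun x => (hGb _).trans_eq (by ring),
    fun ψ hψ hψr => ?_⟩
  have hts : tsupport (fun x => ψ (x - -h)) ⊆ Metric.closedBall 0 r := by
    rw [tsupport_comp_sub]
    intro x hx
    have := hψr hx
    rw [Metric.mem_closedBall, dist_eq_norm] at this
    rw [mem_closedBall_zero_iff]
    simpa using this
  convert hGr _ (isTestD_comp_sub hM hψ (-h)) hts using 1
  · ext α
    rw [mderiv_comp_sub hψ.1, ← integral_sub_right_eq_self
      (fun x => G x * mderiv α ψ (x - -h)) h]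
    simp
  · simp only [LinearMap.comp_apply]
    congr 1
    ext x
    simp [LinearMap.funLeft_apply]

/-- A representation as in `exists_repr_near` on all cells of the integer lattice, for test
functions supported near `W`. -/
lemma exists_repr_cell (hω : OmegaCond ω) {R s : ℝ} (hR : 0 < R) (hs : 0 < s) :
    ∃ a : (Fin d → ℕ) → ℂ, ∃ L > (0 : ℝ), ∃ A > (0 : ℝ),
      (∀ α, ‖a α‖ ≤ (L ^ mOrd α * M (mOrd α))⁻¹) ∧
      ∃ G : (Fin d → ℤ) → Rd d → ℂ, ∀ k, Continuous (G k) ∧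
        (∀ x, ‖x - lattice k‖ ≤ s → ‖G k x‖ ≤ A * ω x) ∧
        ∀ ψ, IsTestD M ψ → tsupport ψ ⊆ Metric.closedBall (lattice k) s →
          tsupport ψ ⊆ W + Metric.ball 0 R →
          HasSum (fun α => a α * ∫ x, G k x * mderiv α ψ x) (f ψ) := by
  obtain ⟨hω0, -, hωR⟩ := hω
  obtain ⟨D, hD, hDω⟩ := hωR (2 * s + R) (by positivity)
  obtain ⟨a, L, hL, A, hA, ha, hrep⟩ := exists_repr_near hM hM2 hM3 hf hbd hω0 (2 * s + R)
  suffices h : ∀ k : Fin d → ℤ, ∃ G : Rd d → ℂ, Continuous G ∧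
      (∀ x, ‖x - lattice k‖ ≤ s → ‖G x‖ ≤ A * D * ω x) ∧
      ∀ ψ, IsTestD M ψ → tsupport ψ ⊆ Metric.closedBall (lattice k) s →
        tsupport ψ ⊆ W + Metric.ball 0 R →
        HasSum (fun α => a α * ∫ x, G x * mderiv α ψ x) (f ψ) by
    choose G hG using h
    exact ⟨a, L, hL, A * D, by positivity, ha, G, hG⟩
  intro k
  by_cases hk : ∃ h ∈ W, ‖h - lattice k‖ ≤ s + R
  · obtain ⟨h, hh, hhk⟩ := hk
    obtain ⟨G, hG, hGb, hGr⟩ := hrep h hh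
    have hnear : ∀ x, ‖x - lattice k‖ ≤ s → ‖h - x‖ ≤ 2 * s + R := fun x hx => by
      have := norm_sub_le (h - lattice k) (x - lattice k)
      rw [sub_sub_sub_cancel_right] at this
      linarith
    refine ⟨G, hG, fun x hx => ?_, fun ψ hψ hψk _ => hGr ψ hψ fun x hx => ?_⟩
    · have := hDω x (h - x) (hnear x hx)
      rw [add_sub_cancel] at this
      calc ‖G x‖ ≤ A * ω h := hGb x
        _ ≤ A * (D * ω x) := by gcongr
        _ = _ := by ring
    · rw [Metric.mem_closedBall, dist_comm, dist_eq_norm]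
      refine hnear x ?_
      rw [← dist_eq_norm]
      exact hψk hx
  · refine ⟨0, continuous_const, fun x _ => ?_, fun ψ hψ hψk hψW => ?_⟩
    · have := hω0 x
      simp only [Pi.zero_apply, norm_zero]
      positivity
    · have hψ0 : ψ = 0 := by
        rw [← tsupport_eq_empty_iff, Set.eq_empty_iff_forall_notMem]
        intro x hx
        obtain ⟨h, hh, y, hy, rfl⟩ := hψW hx
        refine hk ⟨h, hh, ?_⟩
        have h1 := hψk hx
        rw [Metric.mem_closedBall, dist_eq_norm] at h1
        rw [mem_ball_zero_iff] at hy
        have h2 := norm_sub_le (h + y - lattice k) y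
        rw [show h + y - lattice k - y = h - lattice k by abel] at h2
        linarith
      simp [hψ0]

end Cells

section Lattice

lemma abs_sub_le_of_norm_sub_lattice_le {x : Rd d} {k : Fin d → ℤ} {s : ℝ}
    (h : ‖x - lattice k‖ ≤ s) (i : Fin d) : |x i - k i| ≤ s := by
  have := (PiLp.norm_apply_le (x - lattice k) i).trans h
  rwa [Real.norm_eq_abs] at this

lemma mem_box_of_norm_sub_lattice_le {x : Rd d} {k : Fin d → ℤ} {s : ℝ} {N : ℕ}
    (h : ‖x - lattice k‖ ≤ s) (hN : ‖x‖ + s ≤ N) :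
    k ∈ Fintype.piFinset fun _ : Fin d => Finset.Icc (-(N : ℤ)) N := by
  rw [Fintype.mem_piFinset]
  intro i
  have h1 := abs_le.mp (abs_sub_le_of_norm_sub_lattice_le h i)
  have h2 := PiLp.norm_apply_le x i
  rw [Real.norm_eq_abs] at h2
  have h3 := abs_le.mp h2
  rw [Finset.mem_Icc]
  constructor
  · have : (-(N : ℝ)) ≤ k i := by linarith
    exact_mod_cast this
  · have : (k i : ℝ) ≤ N := by linarith
    exact_mod_cast this

lemma exists_card_lattice_le (x : Rd d) {s : ℝ} (hs : 0 ≤ s) :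
    ∃ S : Finset (Fin d → ℤ), (S.card : ℝ) ≤ (2 * s + 1) ^ d ∧
      ∀ k, ‖x - lattice k‖ ≤ s → k ∈ S := by
  refine ⟨Fintype.piFinset fun i => Finset.Icc ⌈x i - s⌉ ⌊x i + s⌋, ?_, fun k hk => ?_⟩
  · rw [Fintype.card_piFinset, Nat.cast_prod]
    refine (Finset.prod_le_prod (g := fun _ => 2 * s + 1) (fun i _ => Nat.cast_nonneg _)
      fun i _ => ?_).trans_eq (by simp)
    rw [Int.card_Icc]
    have h1 := Int.floor_le (x i + s)
    have h2 := Int.le_ceil (x i - s)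
    rcases le_total 0 (⌊x i + s⌋ + 1 - ⌈x i - s⌉) with h | h
    · rw [← Int.cast_natCast, Int.toNat_of_nonneg h]
      push_cast
      linarith
    · rw [Int.toNat_of_nonpos h]
      simp only [Nat.cast_zero]
      positivity
  · rw [Fintype.mem_piFinset]
    intro i
    have h1 := abs_le.mp (abs_sub_le_of_norm_sub_lattice_le hk i)
    rw [Finset.mem_Icc, Int.ceil_le, Int.le_floor]
    constructor <;> linarith

lemma unitBox_subset_closedBall :
    {x : Rd d | ∀ i, x i ∈ Set.Icc (-1 : ℝ) 2} ⊆ Metric.closedBall 0 (√(d * 4) + 1) := by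
  intro x hx
  rw [mem_closedBall_zero_iff, EuclideanSpace.norm_eq]
  refine (Real.sqrt_le_sqrt ?_).trans (le_add_of_nonneg_right zero_le_one)
  refine (Finset.sum_le_card_nsmul _ _ 4 fun i _ => ?_).trans_eq (by simp)
  obtain ⟨h1, h2⟩ := hx i
  rw [Real.norm_eq_abs, sq_abs]
  nlinarith

end Lattice

section LatticeSum

variable {G : (Fin d → ℤ) → Rd d → ℂ} {P : Rd d → ℂ} {s : ℝ} (hP : ∀ x, s < ‖x‖ → P x = 0)
include hP

lemma tsum_lattice_eq {x : Rd d} {N : ℕ} (hN : ‖x‖ + s ≤ N) :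
    ∑' k, G k x * P (x - lattice k)
      = ∑ k ∈ Fintype.piFinset fun _ : Fin d => Finset.Icc (-(N : ℤ)) N,
        G k x * P (x - lattice k) := by
  refine tsum_eq_sum fun k hk => ?_
  rw [hP _ (not_le.mp fun h => hk (mem_box_of_norm_sub_lattice_le h hN)), mul_zero]

lemma continuous_tsum_lattice (hG : ∀ k, Continuous (G k)) (hPc : Continuous P) :
    Continuous fun x => ∑' k, G k x * P (x - lattice k) := by
  rw [continuous_iff_continuousAt]
  intro x₀
  obtain ⟨N, hN⟩ := exists_nat_ge (‖x₀‖ + 1 + s)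
  have hev : (fun x => ∑ k ∈ Fintype.piFinset fun _ : Fin d => Finset.Icc (-(N : ℤ)) N,
      G k x * P (x - lattice k)) =ᶠ[nhds x₀] fun x => ∑' k, G k x * P (x - lattice k) := by
    filter_upwards [Metric.ball_mem_nhds x₀ one_pos] with x hx
    refine (tsum_lattice_eq hP ?_).symm
    rw [mem_ball_iff_norm] at hx
    linarith [norm_le_norm_add_norm_sub' x x₀]
  refine ContinuousAt.congr (Continuous.continuousAt ?_) hev
  exact continuous_finsetSum _ fun k _ =>
    (hG k).mul (hPc.comp (continuous_id.sub continuous_const))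

lemma norm_tsum_lattice_le (hs : 0 ≤ s) {x : Rd d} {g p : ℝ} (hg : 0 ≤ g) (hp : 0 ≤ p)
    (hG : ∀ k, ‖x - lattice k‖ ≤ s → ‖G k x‖ ≤ g) (hPp : ∀ y, ‖P y‖ ≤ p) :
    ‖∑' k, G k x * P (x - lattice k)‖ ≤ (2 * s + 1) ^ d * (g * p) := by
  obtain ⟨S, hS, hSk⟩ := exists_card_lattice_le x hs
  have hfar : ∀ k, ¬ ‖x - lattice k‖ ≤ s → G k x * P (x - lattice k) = 0 := fun k hk => by
    rw [hP _ (not_le.mp hk), mul_zero]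
  rw [tsum_eq_sum (s := S) fun k hk => hfar k fun h => hk (hSk k h)]
  refine (norm_sum_le_of_le (f := fun k => G k x * P (x - lattice k)) S
    (n := fun _ => g * p) fun k _ => ?_).trans ?_
  · by_cases hk : ‖x - lattice k‖ ≤ s
    · rw [norm_mul]
      exact mul_le_mul (hG k hk) (hPp _) (norm_nonneg _) hg
    · rw [hfar k hk, norm_zero]
      positivity
  · rw [Finset.sum_const, nsmul_eq_mul]
    gcongr

end LatticeSum

/-- If the translates of `f` along `W` have growth `ω`, then near `W` it is an infinite sum of
derivatives of continuous functions of growth `ω`. -/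
lemma exists_repr_of_translate_le {M : ℕ → ℝ} (hM : IsM1 M) (hM2 : IsM2' M) (hM3 : IsM3' M)
    {W : Set (Rd d)} {ω : Rd d → ℝ} (hω : OmegaCond ω) {f : (Rd d → ℂ) →ₗ[ℂ] ℂ}
    (hf : IsUltraD M f)
    (hbd : ∀ φ : Rd d → ℂ, IsTestD M φ → ∃ C : ℝ, ∀ h ∈ W, ‖f (fun x => φ (x - h))‖ ≤ C * ω h)
    {R : ℝ} (hR : 0 < R) :
    ∃ F : (Fin d → ℕ) → Rd d → ℂ, (∀ α, Continuous (F α)) ∧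
      ∃ ℓ > (0 : ℝ), ∃ C > (0 : ℝ),
        (∀ α x, ‖F α x‖ ≤ C * (ℓ ^ mOrd α / M (mOrd α)) * ω x) ∧
        ∀ φ : Rd d → ℂ, IsTestD M φ → tsupport φ ⊆ W + Metric.ball 0 R →
          Summable (fun α => ‖∫ x, F α x * mderiv α φ x‖) ∧
          f φ = ∑' α, (-1 : ℂ) ^ mOrd α * ∫ x, F α x * mderiv α φ x := by
  have hω0 := hω.1
  obtain ⟨χ, hχs, hχsupp, hχb, hχsum⟩ := exists_partition (d := d) hM hM3
  set s : ℝ := √(d * 4) + 1 with hs_def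
  have hs : 0 < s := by positivity
  have hχball : tsupport χ ⊆ Metric.closedBall 0 s := hχsupp.trans unitBox_subset_closedBall
  obtain ⟨a, L, hL, A, hA, ha, G, hG⟩ := exists_repr_cell hM hM2 hM3 hf hbd hω hR hs
  obtain ⟨B, hB, hχB⟩ := hχb (L / 4) (by positivity)
  set P := leibnizCoeff a χ with hP_def
  have hP0 : ∀ β x, s < ‖x‖ → P β x = 0 := fun β x hx =>
    leibnizCoeff_eq_zero a hχs β fun h => by
      have := hχball h
      rw [mem_closedBall_zero_iff] at this
      linarith
  have hPc : ∀ β, Continuous (P β) := continuous_leibnizCoeff hM hL ha hχs hB hχB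
  set p := B * M 0 * (∑' α : Fin d → ℕ, (1 / 2 : ℝ) ^ mOrd α) with hp_def
  have hp : 0 ≤ p := mul_nonneg (mul_nonneg hB (hM.1 0).le) (tsum_nonneg fun α => by positivity)
  have hPp : ∀ β x, ‖P β x‖ ≤ p * ((4 / L) ^ mOrd β / M (mOrd β)) :=
    norm_leibnizCoeff_le hM hL ha hB hχB
  set F : (Fin d → ℕ) → Rd d → ℂ := fun β x =>
    (-1) ^ mOrd β * ∑' k, G k x * P β (x - lattice k) with hF_def
  have hFc : ∀ β, Continuous (F β) := fun β =>
    continuous_const.mul (continuous_tsum_lattice (hP0 β) (fun k => (hG k).1) (hPc β))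
  refine ⟨F, hFc, 4 / L, by positivity, (2 * s + 1) ^ d * A * (p + 1), by positivity,
    fun β x => ?_, fun φ hφ hφW => ?_⟩
  · have hMβ := hM.1 (mOrd β)
    have hωx := hω0 x
    simp only [hF_def]
    rw [norm_mul, norm_pow, norm_neg, norm_one, one_pow, one_mul]
    refine (norm_tsum_lattice_le (hP0 β) hs.le (g := A * ω x) (by positivity) (by positivity)
      (fun k => (hG k).2.1 x) (hPp β)).trans ?_
    calc (2 * s + 1) ^ d * (A * ω x * (p * ((4 / L) ^ mOrd β / M (mOrd β))))
        ≤ (2 * s + 1) ^ d * (A * ω x * ((p + 1) * ((4 / L) ^ mOrd β / M (mOrd β)))) := by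
          gcongr
          linarith
      _ = _ := by ring
  obtain ⟨r, hr⟩ := hφ.2.1.isCompact.isBounded.subset_closedBall 0
  obtain ⟨N, hN⟩ := exists_nat_ge (r + s + 2)
  set box := Fintype.piFinset fun _ : Fin d => Finset.Icc (-(N : ℤ)) N with hbox
  have hφr : ∀ x ∈ tsupport φ, ‖x‖ ≤ r := fun x hx => mem_closedBall_zero_iff.mp (hr hx)
  have hdecomp : φ = ∑ k ∈ box, φ * fun x => χ (x - lattice k) := by
    ext x
    rw [Finset.sum_apply]
    simp only [Pi.mul_apply]
    rw [← Finset.mul_sum]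
    by_cases hx : x ∈ tsupport φ
    · rw [hχsum x N fun i => ?_, mul_one]
      have := PiLp.norm_apply_le x i
      rw [Real.norm_eq_abs] at this
      linarith [hφr x hx]
    · rw [image_eq_zero_of_notMem_tsupport hx, zero_mul]
  have hcell : ∀ k, Summable (fun β => ‖∫ x, G k x * P β (x - lattice k) * mderiv β φ x‖) ∧
      HasSum (fun β => ∫ x, G k x * P β (x - lattice k) * mderiv β φ x)
        (f (φ * fun x => χ (x - lattice k))) := by
    intro k
    have hχks : ContDiff ℝ (⊤ : ℕ∞) fun x => χ (x - lattice k) :=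
      hχs.comp (contDiff_id.sub contDiff_const)
    have htest : IsTestD M (φ * fun x => χ (x - lattice k)) := by
      rw [mul_comm]
      refine isTestD_mul hM hχks (fun ε hε => ?_) hφ
      obtain ⟨B', hB', hb⟩ := hχb ε hε
      exact ⟨B', hB', hb.comp_sub hχs _⟩
    have h := hasSum_leibnizCoeff hM hL ha hχks hB (hχB.comp_sub hχs (lattice k)) (hG k).1 hφ
      ((hG k).2.2 _ htest ?_ (tsupport_mul_subset_left.trans hφW))
    · simpa only [leibnizCoeff_comp_sub a hχs] using h
    · refine tsupport_mul_subset_right.trans fun x hx => ?_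
      rw [tsupport_comp_sub] at hx
      have := hχball hx
      rwa [mem_closedBall_zero_iff, ← dist_eq_norm] at this
  have hterm : ∀ β, (-1 : ℂ) ^ mOrd β * ∫ x, F β x * mderiv β φ x
      = ∑ k ∈ box, ∫ x, G k x * P β (x - lattice k) * mderiv β φ x := by
    intro β
    rw [← integral_finsetSum, ← integral_const_mul]
    · refine integral_congr_ae (Filter.Eventually.of_forall fun x => ?_)
      simp only [hF_def]
      by_cases hx : x ∈ tsupport φ
      · rw [tsum_lattice_eq (hP0 β) (N := N) (by linarith [hφr x hx]), ← hbox, ← Finset.sum_mul,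
          ← mul_assoc, ← mul_assoc, ← mul_pow, neg_mul_neg, one_mul, one_pow, one_mul]
      · simp [mderiv_eq_zero hφ.1 β hx]
    · intro k _
      refine Continuous.integrable_of_hasCompactSupport (((hG k).1.mul
        ((hPc β).comp (continuous_id.sub continuous_const))).mul
          (contDiff_mderiv hφ.1 β).continuous) (HasCompactSupport.mul_left ?_)
      exact hφ.2.1.of_isClosed_subset (isClosed_tsupport _) (tsupport_mderiv_subset hφ.1 β)
  have hsum : HasSum (fun β => (-1 : ℂ) ^ mOrd β * ∫ x, F β x * mderiv β φ x) (f φ) := by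
    simp_rw [hterm]
    rw [show f φ = ∑ k ∈ box, f (φ * fun x => χ (x - lattice k)) by
      rw [← map_sum, ← hdecomp]]
    exact hasSum_sum fun k _ => (hcell k).2
  refine ⟨?_, hsum.tsum_eq.symm⟩
  refine Summable.of_nonneg_of_le (fun β => norm_nonneg _) (fun β => ?_)
    (summable_sum fun k (_ : k ∈ box) => (hcell k).1)
  calc ‖∫ x, F β x * mderiv β φ x‖
      = ‖(-1 : ℂ) ^ mOrd β * ∫ x, F β x * mderiv β φ x‖ := by
        rw [norm_mul, norm_pow, norm_neg, norm_one, one_pow, one_mul]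
    _ ≤ _ := by
        rw [hterm]
        exact norm_sum_le _ _

/-- structural characterization of S-asymptotic boundedness
`f(x+h) = O(ω(h))`, `h ∈ W`, on an unbounded set `W`. -/
theorem stmt8 {d : ℕ} (M : ℕ → ℝ) (hM1 : IsM1 M) (hM2' : IsM2' M) (hM3' : IsM3' M)
    (W : Set (Rd d)) (hW : ¬ Bornology.IsBounded W)
    (ω : Rd d → ℝ) (hω : OmegaCond ω)
    (f : (Rd d → ℂ) →ₗ[ℂ] ℂ) (hf : IsUltraD M f) :
    (∀ φ : Rd d → ℂ, IsTestD M φ →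
        ∃ C : ℝ, ∀ h ∈ W, ‖f (fun x => φ (x - h))‖ ≤ C * ω h) ↔
      (∀ R > (0 : ℝ), ∃ F : (Fin d → ℕ) → Rd d → ℂ,
        (∀ α, ContinuousOn (F α) (W + Metric.ball 0 R)) ∧
        ∃ ℓ > (0 : ℝ), ∃ C > (0 : ℝ),
          (∀ (α : Fin d → ℕ), ∀ x ∈ W + Metric.ball 0 R,
            ‖F α x‖ ≤ C * (ℓ ^ mOrd α / M (mOrd α)) * ω x) ∧
          ∀ φ : Rd d → ℂ, IsTestD M φ → tsupport φ ⊆ W + Metric.ball 0 R →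
            (∀ α : Fin d → ℕ,
              IntegrableOn (fun x => F α x * mderiv α φ x) (W + Metric.ball 0 R)) ∧
            Summable (fun α : Fin d → ℕ =>
              ‖∫ x in W + Metric.ball 0 R, F α x * mderiv α φ x‖) ∧
            f φ = ∑' α : Fin d → ℕ,
              (-1 : ℂ) ^ mOrd α * ∫ x in W + Metric.ball 0 R, F α x * mderiv α φ x) := by
  constructor
  · intro hbd R hR
    obtain ⟨F, hFc, ℓ, hℓ, C, hC, hFb, hrep⟩ :=
      exists_repr_of_translate_le hM1 hM2' hM3' hω hf hbd hR
    refine ⟨F, fun α => (hFc α).continuousOn, ℓ, hℓ, C, hC, fun α x _ => hFb α x,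
      fun φ hφ hφW => ?_⟩
    have hfull : ∀ α, ∫ x in W + Metric.ball 0 R, F α x * mderiv α φ x
        = ∫ x, F α x * mderiv α φ x := fun α =>
      setIntegral_eq_integral_of_forall_compl_eq_zero fun x hx => by
        rw [mderiv_eq_zero hφ.1 α fun h => hx (hφW h), mul_zero]
    simp_rw [hfull]
    refine ⟨fun α => Integrable.integrableOn ?_, hrep φ hφ hφW⟩
    refine ((hFc α).mul (contDiff_mderiv hφ.1 α).continuous).integrable_of_hasCompactSupport
      (HasCompactSupport.mul_left ?_)
    exact hφ.2.1.of_isClosed_subset (isClosed_tsupport _) (tsupport_mderiv_subset hφ.1 α)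
  · intro h φ hφ
    obtain ⟨r, hr⟩ := hφ.2.1.isCompact.isBounded.subset_closedBall 0
    obtain ⟨F, -, ℓ, hℓ, C, hC, hFb, hrep⟩ := h (max r 1 + 1) (by positivity)
    exact exists_translate_le_of_repr hM1 hω hφ (by positivity) hℓ hC
      (hr.trans (Metric.closedBall_subset_closedBall (le_max_left r 1))) hFb
      fun ψ hψ hψW => (hrep ψ hψ hψW).2.2
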